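/- arXiv:2502.10885 — 3 statements merged into one kernel-verified Lean document; each statement's English description precedes it below -/
import Mathlib

section
/- For all a ∈ (0,1], b > 0 and c ≥ 1/a, we have ∑_{n=1}^∞ c^{-n} ∫₀^∞ e^{a x - b/x} x^{n - 3/2} Γ(1-n, x) dx = 2√π ∫_{√(1-a)}^∞ e^{-2√b u} / (c u² + a c - 1) du, where Γ(p, y) is the upper incomplete Gamma function; in the case a = 1, c = 1, both sides are interpreted as possibly infinite and the series diverges. -/
open MeasureTheory Real Set

/-- Upper incomplete Gamma function `Γ(p, x) = ∫_x^∞ u^(p-1) e^(-u) du`. -/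
noncomputable def uGamma (p x : ℝ) : ℝ := ∫ u in Set.Ioi x, u ^ (p - 1) * Real.exp (-u)

theorem lintegral_exp_neg_sq :
    ∫⁻ v : ℝ, ENNReal.ofReal (exp (-v ^ 2)) = ENNReal.ofReal √π := by
  have h := integral_gaussian 1
  have hi := integrable_exp_neg_mul_sq (b := 1) one_pos
  simp only [neg_mul, one_mul, div_one] at h hi
  rw [← h, ofReal_integral_eq_lintegral_ofReal hi (ae_of_all _ fun v => (exp_pos _).le)]

theorem image_mul_sub_div_Ioi {p q : ℝ} (hp : 0 < p) (hq : 0 < q) :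
    (fun y : ℝ => p * y - q / y) '' Ioi 0 = univ := by
  refine eq_univ_of_forall fun v => ?_
  have hs : |v| < √(v ^ 2 + 4 * p * q) := by
    rw [← sqrt_sq_eq_abs]
    exact sqrt_lt_sqrt (sq_nonneg v) (by nlinarith [mul_pos hp hq])
  have hsq : √(v ^ 2 + 4 * p * q) ^ 2 = v ^ 2 + 4 * p * q := sq_sqrt (by positivity)
  have hy : 0 < v + √(v ^ 2 + 4 * p * q) := by linarith [neg_abs_le v]
  refine ⟨(v + √(v ^ 2 + 4 * p * q)) / (2 * p), div_pos hy (by positivity), ?_⟩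
  generalize √(v ^ 2 + 4 * p * q) = S at *
  have := hy.ne'
  field_simp
  linear_combination hsq

theorem injOn_mul_sub_div_Ioi {p q : ℝ} (hp : 0 < p) (hq : 0 < q) :
    InjOn (fun y : ℝ => p * y - q / y) (Ioi 0) := by
  refine StrictMonoOn.injOn fun x hx y hy hxy => ?_
  have h₁ : p * x < p * y := by gcongr
  have h₂ : q / y < q / x := div_lt_div_of_pos_left hq hx hxy
  linarith

theorem lintegral_Ioi_exp_neg_inv_eq {p q : ℝ} (hp : 0 < p) (hq : 0 < q) :
    ∫⁻ y in Ioi (0 : ℝ), ENNReal.ofReal (q / y ^ 2) *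
        ENNReal.ofReal (exp (-(p * y - q / y) ^ 2))
      = ENNReal.ofReal p *
        ∫⁻ y in Ioi (0 : ℝ), ENNReal.ofReal (exp (-(p * y - q / y) ^ 2)) := by
  have himg : (fun y : ℝ => q / p / y) '' Ioi 0 = Ioi 0 := by
    ext z
    refine ⟨?_, fun hz => ⟨q / p / z, div_pos (div_pos hq hp) hz, ?_⟩⟩
    · rintro ⟨y, hy, rfl⟩
      exact div_pos (div_pos hq hp) hy
    · have : z ≠ 0 := ne_of_gt hz
      field_simp
  have hinj : InjOn (fun y : ℝ => q / p / y) (Ioi 0) := by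
    intro x hx y hy h
    have hx' : x ≠ 0 := ne_of_gt hx
    have hy' : y ≠ 0 := ne_of_gt hy
    simp only at h
    field_simp at h
    exact h.symm
  have hderiv : ∀ y ∈ Ioi (0 : ℝ),
      HasDerivWithinAt (fun y : ℝ => q / p / y) (-(q / p / y ^ 2)) (Ioi 0) y := by
    intro y hy
    have := ((hasDerivAt_inv (ne_of_gt hy)).const_mul (q / p)).hasDerivWithinAt (s := Ioi 0)
    simpa [div_eq_mul_inv] using this
  have h := lintegral_image_eq_lintegral_abs_deriv_mul measurableSet_Ioi hderiv hinj
    fun y => ENNReal.ofReal (exp (-(p * y - q / y) ^ 2))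
  rw [himg] at h
  rw [h, ← lintegral_const_mul' _ _ ENNReal.ofReal_ne_top]
  refine setLIntegral_congr_fun measurableSet_Ioi fun y hy => ?_
  have hy : 0 < y := hy
  rw [← mul_assoc, ← ENNReal.ofReal_mul hp.le, abs_neg, abs_of_pos (by positivity)]
  congr 2
  · field_simp
  · congr 2
    field_simp
    ring

theorem lintegral_Ioi_exp_neg_sq_mul_sub_div {p q : ℝ} (hp : 0 < p) (hq : 0 < q) :
    ∫⁻ y in Ioi (0 : ℝ), ENNReal.ofReal (exp (-(p * y - q / y) ^ 2))
      = ENNReal.ofReal (√π / (2 * p)) := by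
  have hderiv : ∀ y ∈ Ioi (0 : ℝ),
      HasDerivWithinAt (fun y : ℝ => p * y - q / y) (p + q / y ^ 2) (Ioi 0) y := by
    intro y hy
    have := (((hasDerivAt_id y).const_mul p).sub
      ((hasDerivAt_inv (ne_of_gt hy)).const_mul q)).hasDerivWithinAt (s := Ioi 0)
    refine (this.congr_deriv ?_)
    simp [div_eq_mul_inv]
  have h := lintegral_image_eq_lintegral_abs_deriv_mul measurableSet_Ioi hderiv
    (injOn_mul_sub_div_Ioi hp hq) fun v => ENNReal.ofReal (exp (-v ^ 2))
  rw [image_mul_sub_div_Ioi hp hq, Measure.restrict_univ, lintegral_exp_neg_sq] at h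
  have hsplit : ∫⁻ y in Ioi (0 : ℝ), ENNReal.ofReal |p + q / y ^ 2| *
        ENNReal.ofReal (exp (-(p * y - q / y) ^ 2)) =
      ∫⁻ y in Ioi (0 : ℝ), (ENNReal.ofReal p * ENNReal.ofReal (exp (-(p * y - q / y) ^ 2)) +
        ENNReal.ofReal (q / y ^ 2) * ENNReal.ofReal (exp (-(p * y - q / y) ^ 2))) := by
    refine setLIntegral_congr_fun measurableSet_Ioi fun y hy => ?_
    have hy : 0 < y := hy
    rw [abs_of_pos (by positivity), ENNReal.ofReal_add hp.le (by positivity), add_mul]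
  rw [hsplit, lintegral_add_left (by fun_prop), lintegral_const_mul' _ _ ENNReal.ofReal_ne_top,
    lintegral_Ioi_exp_neg_inv_eq hp hq, ← two_mul, ← mul_assoc] at h
  have h2 : (2 : ENNReal) * ENNReal.ofReal p = ENNReal.ofReal (2 * p) := by
    rw [ENNReal.ofReal_mul two_pos.le]; simp
  rw [h2] at h
  rw [ENNReal.ofReal_div_of_pos (by positivity), h, mul_comm, ENNReal.mul_div_cancel_right]
  · simpa using hp
  · exact ENNReal.ofReal_ne_top

/-- Change of variables `t = u ^ 2 + a`. -/
theorem lintegral_Ioi_eq_lintegral_sq_add {a r : ℝ} (har : a ≤ r) (g : ℝ → ENNReal) :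
    ∫⁻ t in Ioi r, g t = ∫⁻ u in Ioi √(r - a), ENNReal.ofReal (2 * u) * g (u ^ 2 + a) := by
  have hpos : ∀ u ∈ Ioi √(r - a), 0 < u := fun u hu => (sqrt_nonneg _).trans_lt hu
  have himg : (fun u : ℝ => u ^ 2 + a) '' Ioi √(r - a) = Ioi r := by
    ext t
    constructor
    · rintro ⟨u, hu, rfl⟩
      have := (sqrt_lt' (hpos u hu)).1 hu
      simp only [mem_Ioi]
      linarith
    · intro ht
      have ht : r < t := ht
      refine ⟨√(t - a), sqrt_lt_sqrt (by linarith) (by linarith), ?_⟩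
      change √(t - a) ^ 2 + a = t
      rw [sq_sqrt (by linarith)]
      ring
  have hinj : InjOn (fun u : ℝ => u ^ 2 + a) (Ioi √(r - a)) := by
    intro u hu v hv h
    exact (pow_left_inj₀ (hpos u hu).le (hpos v hv).le two_ne_zero).1 (add_right_cancel h)
  have hderiv : ∀ u ∈ Ioi √(r - a),
      HasDerivWithinAt (fun u : ℝ => u ^ 2 + a) (2 * u) (Ioi √(r - a)) u := by
    intro u _
    simpa using ((hasDerivAt_pow 2 u).add_const a).hasDerivWithinAt (s := Ioi √(r - a))
  rw [← himg, lintegral_image_eq_lintegral_abs_deriv_mul measurableSet_Ioi hderiv hinj]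
  refine setLIntegral_congr_fun measurableSet_Ioi fun u hu => ?_
  rw [abs_of_pos (by linarith [hpos u hu])]

theorem lintegral_Ioi_exp_neg_mul_sub_div_sqrt {s b : ℝ} (hs : 0 < s) (hb : 0 < b) :
    ∫⁻ x in Ioi (0 : ℝ), ENNReal.ofReal (exp (-(s * x) - b / x) / √x)
      = ENNReal.ofReal (√π / √s * exp (-2 * √b * √s)) := by
  have hs' := sqrt_pos.2 hs
  have hb' := sqrt_pos.2 hb
  have hJ := lintegral_Ioi_exp_neg_sq_mul_sub_div hs' hb'
  rw [lintegral_Ioi_eq_lintegral_sq_add (a := 0) le_rfl]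
  have hfun : ∫⁻ y in Ioi √((0 : ℝ) - 0), ENNReal.ofReal (2 * y) *
        ENNReal.ofReal (exp (-(s * (y ^ 2 + 0)) - b / (y ^ 2 + 0)) / √(y ^ 2 + 0)) =
      ∫⁻ y in Ioi (0 : ℝ), ENNReal.ofReal (2 * exp (-2 * √b * √s)) *
        ENNReal.ofReal (exp (-(√s * y - √b / y) ^ 2)) := by
    rw [sub_zero, sqrt_zero]
    refine setLIntegral_congr_fun measurableSet_Ioi fun y hy => ?_
    have hy : 0 < y := hy
    simp only [add_zero]
    rw [← ENNReal.ofReal_mul (by positivity), ← ENNReal.ofReal_mul (by positivity),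
      sqrt_sq hy.le, mul_assoc 2 (exp _), ← exp_add]
    have : -2 * √b * √s + -(√s * y - √b / y) ^ 2 = -(s * y ^ 2) - b / y ^ 2 := by
      nth_rewrite 3 [← sq_sqrt hs.le]
      nth_rewrite 3 [← sq_sqrt hb.le]
      field_simp
      ring
    rw [this]
    congr 1
    field_simp
  rw [hfun, lintegral_const_mul' _ _ ENNReal.ofReal_ne_top, hJ,
    ← ENNReal.ofReal_mul (by positivity)]
  congr 1
  field_simp

theorem measurable_uGamma (p : ℝ) : Measurable (uGamma p) := by
  have hm : StronglyMeasurable (Function.uncurry fun x u : ℝ =>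
      (Ioi x).indicator (fun u : ℝ => u ^ (p - 1) * exp (-u)) u) := by
    have hset : MeasurableSet {z : ℝ × ℝ | z.1 < z.2} :=
      measurableSet_lt measurable_fst measurable_snd
    have hf : Measurable fun z : ℝ × ℝ => z.2 ^ (p - 1) * exp (-z.2) := by fun_prop
    exact (hf.indicator hset).stronglyMeasurable
  have h := hm.integral_prod_right (ν := volume)
  convert h.measurable using 1
  ext x
  exact (integral_indicator measurableSet_Ioi).symm

theorem ofReal_uGamma_eq_lintegral (n : ℕ) {x : ℝ} (hx : 0 < x) :
    ENNReal.ofReal (x ^ ((n + 1 : ℝ) - 3 / 2) * uGamma (1 - (n + 1)) x)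
      = ∫⁻ t in Ioi (1 : ℝ), ENNReal.ofReal (exp (-(x * t)) / √x / t ^ (n + 1)) := by
  have hpow : ∀ u ∈ Ioi x, u ^ ((1 - (n + 1 : ℝ)) - 1) * exp (-u) = exp (-u) / u ^ (n + 1) := by
    intro u hu
    have hu : 0 < u := hx.trans hu
    rw [show (1 - (n + 1 : ℝ)) - 1 = -((n + 1 : ℕ) : ℝ) by push_cast; ring, rpow_neg hu.le,
      rpow_natCast]
    field_simp
  have hint : IntegrableOn (fun u : ℝ => exp (-u) / u ^ (n + 1)) (Ioi x) := by
    refine ((integrableOn_exp_neg_Ioi x).div_const (x ^ (n + 1))).mono'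
      (Measurable.aestronglyMeasurable (by fun_prop)) ?_
    refine (ae_restrict_iff' measurableSet_Ioi).2 (ae_of_all _ fun u hu => ?_)
    have hxu : x < u := hu
    have hu : 0 < u := hx.trans hxu
    rw [norm_of_nonneg (by positivity)]
    gcongr
  have hG : ENNReal.ofReal (uGamma (1 - (n + 1)) x) =
      ∫⁻ u in Ioi x, ENNReal.ofReal (exp (-u) / u ^ (n + 1)) := by
    rw [uGamma, setIntegral_congr_fun measurableSet_Ioi hpow,
      ofReal_integral_eq_lintegral_ofReal hint]
    refine (ae_restrict_iff' measurableSet_Ioi).2 (ae_of_all _ fun u hu => ?_)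
    have hu : 0 < u := hx.trans hu
    simp only [Pi.zero_apply]
    positivity
  have himg : (fun t : ℝ => x * t) '' Ioi 1 = Ioi x := by
    simpa using image_mul_left_Ioi hx 1
  have hderiv : ∀ t ∈ Ioi (1 : ℝ), HasDerivWithinAt (fun t : ℝ => x * t) x (Ioi 1) t := by
    intro t _
    simpa using ((hasDerivAt_id t).const_mul x).hasDerivWithinAt (s := Ioi 1)
  rw [ENNReal.ofReal_mul (by positivity), hG, ← himg,
    lintegral_image_eq_lintegral_abs_deriv_mul measurableSet_Ioi hderiv
      (mul_right_injective₀ hx.ne').injOn, ← lintegral_const_mul' _ _ ENNReal.ofReal_ne_top]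
  refine setLIntegral_congr_fun measurableSet_Ioi fun t ht => ?_
  have ht : 0 < t := one_pos.trans ht
  rw [← ENNReal.ofReal_mul (by positivity), ← ENNReal.ofReal_mul (by positivity), abs_of_pos hx]
  congr 1
  have hxp : x ^ ((n + 1 : ℝ) - 3 / 2) = x ^ n / √x := by
    rw [sqrt_eq_rpow, ← rpow_natCast x n, ← rpow_sub hx]
    congr 1
    ring
  rw [hxp]
  field_simp
  ring

theorem lintegral_Ioi_uGamma {a b : ℝ} (ha : a ≤ 1) (hb : 0 < b) (n : ℕ) :
    ∫⁻ x in Ioi (0 : ℝ), ENNReal.ofReal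
        (exp (a * x - b / x) * x ^ ((n + 1 : ℝ) - 3 / 2) * uGamma (1 - (n + 1)) x)
      = ∫⁻ u in Ioi √(1 - a),
          ENNReal.ofReal (2 * √π * exp (-2 * √b * u) / (u ^ 2 + a) ^ (n + 1)) := by
  have hin : ∫⁻ x in Ioi (0 : ℝ), ENNReal.ofReal
        (exp (a * x - b / x) * x ^ ((n + 1 : ℝ) - 3 / 2) * uGamma (1 - (n + 1)) x)
      = ∫⁻ x in Ioi (0 : ℝ), ∫⁻ t in Ioi (1 : ℝ),
          ENNReal.ofReal (exp (-((t - a) * x) - b / x) / √x / t ^ (n + 1)) := by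
    refine setLIntegral_congr_fun measurableSet_Ioi fun x hx => ?_
    have hx : 0 < x := hx
    rw [mul_assoc, ENNReal.ofReal_mul (exp_pos _).le, ofReal_uGamma_eq_lintegral n hx,
      ← lintegral_const_mul' _ _ ENNReal.ofReal_ne_top]
    refine lintegral_congr fun t => ?_
    rw [← ENNReal.ofReal_mul (exp_pos _).le, ← mul_div_assoc, ← mul_div_assoc, ← exp_add]
    congr 4
    ring
  rw [hin, lintegral_lintegral_swap (by fun_prop), lintegral_Ioi_eq_lintegral_sq_add ha]
  refine setLIntegral_congr_fun measurableSet_Ioi fun u hu => ?_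
  have hu0 : 0 < u := (sqrt_nonneg _).trans_lt hu
  have hu1 : 0 < u ^ 2 + a := by linarith [(sqrt_lt' hu0).1 hu]
  simp only [add_sub_cancel_right]
  simp_rw [div_eq_mul_inv _ ((u ^ 2 + a) ^ (n + 1)),
    ENNReal.ofReal_mul' (inv_nonneg.2 (pow_pos hu1 (n + 1)).le)]
  rw [lintegral_mul_const' _ _ ENNReal.ofReal_ne_top,
    lintegral_Ioi_exp_neg_mul_sub_div_sqrt (pow_pos hu0 2) hb, ← mul_assoc,
    ← ENNReal.ofReal_mul (by positivity), sqrt_sq hu0.le]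
  congr 2
  field_simp

theorem ofReal_integral_Ioi_uGamma {a b : ℝ} (ha : a ∈ Ioc (0 : ℝ) 1) (hb : 0 < b) (n : ℕ) :
    ENNReal.ofReal (∫ x in Ioi (0 : ℝ),
        exp (a * x - b / x) * x ^ ((n + 1 : ℝ) - 3 / 2) * uGamma (1 - (n + 1)) x)
      = ∫⁻ u in Ioi √(1 - a),
          ENNReal.ofReal (2 * √π * exp (-2 * √b * u) / (u ^ 2 + a) ^ (n + 1)) := by
  have ha0 := ha.1
  have hnonneg : ∀ x ∈ Ioi (0 : ℝ),
      0 ≤ exp (a * x - b / x) * x ^ ((n + 1 : ℝ) - 3 / 2) * uGamma (1 - (n + 1)) x := by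
    intro x hx
    have hx : 0 < x := hx
    refine mul_nonneg (by positivity) (setIntegral_nonneg measurableSet_Ioi fun u hu => ?_)
    have hu : 0 < u := hx.trans hu
    positivity
  have hmeas := measurable_uGamma (1 - (n + 1))
  rw [integral_eq_lintegral_of_nonneg_ae
    ((ae_restrict_iff' measurableSet_Ioi).2 (ae_of_all _ hnonneg))
    (Measurable.aestronglyMeasurable (by fun_prop)), lintegral_Ioi_uGamma ha.2 hb n]
  refine ENNReal.ofReal_toReal (ne_of_lt ?_)
  have hint : IntegrableOn (fun u => 2 * √π * exp (-2 * √b * u) / a ^ (n + 1))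
      (Ioi √(1 - a)) := by
    refine ((integrableOn_exp_mul_Ioi ?_ _).const_mul _).div_const _
    linarith [sqrt_pos.2 hb]
  refine lt_of_le_of_lt (lintegral_mono fun u => ENNReal.ofReal_le_ofReal ?_)
    hint.lintegral_lt_top
  gcongr
  nlinarith [sq_nonneg u]

theorem hasSum_inv_pow_succ {z : ℝ} (hz : 1 < z) :
    HasSum (fun n : ℕ => (z ^ (n + 1))⁻¹) (z - 1)⁻¹ := by
  have hz0 : z ≠ 0 := by linarith
  have hterm : (fun n : ℕ => (z ^ (n + 1))⁻¹) = fun n => z⁻¹ * z⁻¹ ^ n := by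
    ext n
    rw [← inv_pow, pow_succ']
  have hlim : (z - 1)⁻¹ = z⁻¹ * (1 - z⁻¹)⁻¹ := by
    rw [← mul_inv, mul_sub, mul_one, mul_inv_cancel₀ hz0]
  rw [hterm, hlim]
  exact (hasSum_geometric_of_lt_one (inv_nonneg.2 (by linarith))
    (inv_lt_one_of_one_lt₀ hz)).mul_left z⁻¹

theorem series_integral_uGamma (a b c : ℝ) (ha : a ∈ Set.Ioc (0:ℝ) 1) (hb : 0 < b)
    (hc : 1 / a ≤ c) :
    ∑' n : ℕ,
        ENNReal.ofReal ((1 / c) ^ (n + 1) *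
          ∫ x in Set.Ioi (0:ℝ),
            Real.exp (a * x - b / x) * x ^ ((n + 1 : ℝ) - 3 / 2) * uGamma (1 - (n + 1)) x)
      = ENNReal.ofReal (2 * Real.sqrt Real.pi) *
        ∫⁻ u in Set.Ioi (Real.sqrt (1 - a)),
          ENNReal.ofReal (Real.exp (-2 * Real.sqrt b * u) / (c * u ^ 2 + a * c - 1)) := by
  have ha0 : 0 < a := ha.1
  have hc0 : 0 < c := (one_div_pos.2 ha0).trans_le hc
  have hac : 1 ≤ c * a := (div_le_iff₀ ha0).1 hc
  have hterm : ∀ n : ℕ, ENNReal.ofReal ((1 / c) ^ (n + 1) * ∫ x in Ioi (0 : ℝ),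
        exp (a * x - b / x) * x ^ ((n + 1 : ℝ) - 3 / 2) * uGamma (1 - (n + 1)) x)
      = ∫⁻ u in Ioi √(1 - a), ENNReal.ofReal
          (2 * √π * exp (-2 * √b * u) * ((c * (u ^ 2 + a)) ^ (n + 1))⁻¹) := by
    intro n
    rw [ENNReal.ofReal_mul (by positivity), ofReal_integral_Ioi_uGamma ha hb n,
      ← lintegral_const_mul' _ _ ENNReal.ofReal_ne_top]
    refine lintegral_congr fun u => ?_
    rw [← ENNReal.ofReal_mul (by positivity)]
    congr 1
    rw [mul_pow, one_div, inv_pow]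
    field_simp
  simp_rw [hterm]
  rw [← lintegral_tsum fun n => by fun_prop, ← lintegral_const_mul' _ _ ENNReal.ofReal_ne_top]
  refine setLIntegral_congr_fun measurableSet_Ioi fun u hu => ?_
  have hu0 : 0 < u := (sqrt_nonneg _).trans_lt hu
  have hz : 1 < c * (u ^ 2 + a) := by nlinarith [mul_pos hc0 (pow_pos hu0 2)]
  have hsum := (hasSum_inv_pow_succ hz).mul_left (2 * √π * exp (-2 * √b * u))
  rw [← ENNReal.ofReal_tsum_of_nonneg (fun n => by positivity) hsum.summable, hsum.tsum_eq,
    ← ENNReal.ofReal_mul (by positivity)]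
  congr 1
  rw [show c * u ^ 2 + a * c - 1 = c * (u ^ 2 + a) - 1 by ring]
  ring
end

section
/- For all b > 0, u > 0, and A ∈ ℝ \ ℤ, ∫₀^∞ exp(-b/x - u x) x^A dx = 2 (b/u)^{(A+1)/2} K_{A+1}(2√(b u)), where K_ν is the modified Bessel function of the second kind. -/
open MeasureTheory Real Set

/-- Modified Bessel function of the first kind. -/
noncomputable def besselI (α x : ℝ) : ℝ :=
  ∑' m : ℕ, (x / 2) ^ (2 * (m : ℝ) + α) / ((m.factorial : ℝ) * Real.Gamma ((m : ℝ) + α + 1))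

/-- Modified Bessel function of the second kind. -/
noncomputable def besselK (α x : ℝ) : ℝ :=
  Real.pi / 2 * (besselI (-α) x - besselI α x) / Real.sin (Real.pi * α)

open Filter Topology

/-- The regularized confluent hypergeometric limit function
`₀F₁(; c; z) / Γ(c) = ∑ zᵐ / (m! Γ(m + c))`. -/
noncomputable def regularizedHGLimit (c z : ℝ) : ℝ :=
  ∑' m : ℕ, z ^ m / ((m.factorial : ℝ) * Real.Gamma ((m : ℝ) + c))

lemma exists_abs_inv_Gamma_nat_add_le (c : ℝ) :
    ∃ C, ∀ m : ℕ, |(Real.Gamma ((m : ℝ) + c))⁻¹| ≤ C := by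
  have h : IsBoundedUnder (· ≤ ·) atTop fun m : ℕ => |(Real.Gamma ((m : ℝ) + c))⁻¹| := by
    refine isBoundedUnder_of_eventually_le (a := 1) ?_
    filter_upwards [(tendsto_atTop_add_const_right atTop c
      tendsto_natCast_atTop_atTop).eventually_ge_atTop 2] with m hm
    have h1 : 1 ≤ Real.Gamma (m + c) :=
      Real.Gamma_two ▸ Real.Gamma_strictMonoOn_Ici.monotoneOn self_mem_Ici hm hm
    rw [abs_of_nonneg (inv_nonneg.2 (zero_le_one.trans h1))]
    exact inv_le_one_of_one_le₀ h1
  obtain ⟨C, hC⟩ := h.bddAbove_range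
  exact ⟨C, fun m => hC (mem_range_self m)⟩

lemma summable_regularizedHGLimit (c z : ℝ) :
    Summable fun m : ℕ => z ^ m / ((m.factorial : ℝ) * Real.Gamma ((m : ℝ) + c)) := by
  obtain ⟨C, hC⟩ := exists_abs_inv_Gamma_nat_add_le c
  refine Summable.of_norm_bounded ((Real.summable_pow_div_factorial |z|).mul_right C) fun m => ?_
  rw [← div_div, div_eq_mul_inv (_ / _), norm_mul, norm_div, norm_pow, norm_natCast]
  gcongr
  · exact le_rfl
  · exact hC m

lemma hasSum_deriv_regularizedHGLimit (c z : ℝ) :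
    HasSum (fun m : ℕ => (m * z ^ (m - 1)) / ((m.factorial : ℝ) * Real.Gamma ((m : ℝ) + c)))
      (regularizedHGLimit (c + 1) z) := by
  rw [← hasSum_nat_add_iff' 1]
  have h := (summable_regularizedHGLimit (c + 1) z).hasSum
  simp only [Finset.range_one, Finset.sum_singleton, Nat.cast_zero, zero_mul, zero_div, sub_zero]
  refine h.congr_fun fun m => ?_
  rw [Nat.factorial_succ, Nat.add_sub_cancel]
  push_cast
  rw [mul_assoc, mul_div_mul_left _ _ (by positivity), add_assoc, add_comm 1 c]

lemma hasDerivAt_regularizedHGLimit (c z : ℝ) :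
    HasDerivAt (regularizedHGLimit c) (regularizedHGLimit (c + 1) z) z := by
  obtain ⟨C, hC⟩ := exists_abs_inv_Gamma_nat_add_le c
  have hC0 : 0 ≤ C := (abs_nonneg _).trans (hC 0)
  set R := |z| + 1
  have hR : 0 ≤ R := by positivity
  have hu : Summable fun m : ℕ => (m * R ^ (m - 1)) / (m.factorial : ℝ) * C := by
    refine Summable.mul_right C ?_
    rw [← summable_nat_add_iff 1]
    refine (Real.summable_pow_div_factorial R).congr fun m => ?_
    rw [Nat.factorial_succ]
    rw [Nat.add_sub_cancel]
    push_cast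
    rw [mul_div_mul_left _ _ (by positivity)]
  have key := hasDerivAt_tsum_of_isPreconnected
    (g := fun (m : ℕ) z => z ^ m / ((m.factorial : ℝ) * Real.Gamma ((m : ℝ) + c)))
    (g' := fun (m : ℕ) z => (m * z ^ (m - 1)) / ((m.factorial : ℝ) * Real.Gamma ((m : ℝ) + c)))
    hu (t := Ioo (-R) R) isOpen_Ioo isPreconnected_Ioo
    (fun m y _ => (hasDerivAt_pow m y).div_const _)
    (fun m y hy => by
      rw [← div_div, div_eq_mul_inv (_ / _), norm_mul, norm_div, norm_mul, norm_pow, norm_natCast,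
        norm_natCast]
      have : ‖y‖ ≤ R := abs_le.2 ⟨hy.1.le, hy.2.le⟩
      gcongr
      exact hC m)
    (y₀ := z) (by rw [mem_Ioo, ← abs_lt]; simp [R]) (summable_regularizedHGLimit c z)
    (y := z) (by rw [mem_Ioo, ← abs_lt]; simp [R])
  rwa [(hasSum_deriv_regularizedHGLimit c z).tsum_eq] at key

lemma regularizedHGLimit_zero (c : ℝ) : regularizedHGLimit c 0 = (Real.Gamma c)⁻¹ := by
  rw [regularizedHGLimit, tsum_eq_single 0]
  · simp
  · intro m hm
    simp [hm]

lemma regularizedHGLimit_eq {c : ℝ} (hc : ∀ n : ℤ, c ≠ n) (z : ℝ) :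
    regularizedHGLimit c z =
      c * regularizedHGLimit (c + 1) z + z * regularizedHGLimit (c + 2) z := by
  have hG : ∀ m : ℕ, Real.Gamma (m + (c + 1)) = (m + c) * Real.Gamma (m + c) := by
    intro m
    rw [← add_assoc, Real.Gamma_add_one]
    intro h
    exact hc (-m) (by push_cast; linarith)
  have h0 : ∀ m : ℕ, (m : ℝ) + c ≠ 0 := by
    intro m h
    exact hc (-m) (by push_cast; linarith)
  have h1 := (summable_regularizedHGLimit (c + 1) z).hasSum.mul_left c
  have h2 := (hasSum_deriv_regularizedHGLimit (c + 1) z).mul_left z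
  rw [show c + 2 = c + 1 + 1 by ring]
  refine HasSum.tsum_eq ((h1.add h2).congr_fun fun m => ?_)
  have hz : z * (m * z ^ (m - 1)) = m * z ^ m := by
    rcases m with _ | m
    · simp
    · rw [Nat.add_sub_cancel]
      ring
  rw [← mul_div_assoc z, hz, hG]
  have := h0 m
  by_cases hΓ : Real.Gamma (m + c) = 0
  · simp [hΓ]
  · field_simp
    ring

/-- The series representation of `2 z ^ (ν / 2) K_ν(2 √z)`, for `ν` not an integer. -/
noncomputable def macdonaldSeries (ν z : ℝ) : ℝ :=
  π / sin (π * ν) * (regularizedHGLimit (1 - ν) z - z ^ ν * regularizedHGLimit (1 + ν) z)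

lemma macdonaldSeries_neg (ν : ℝ) {z : ℝ} (hz : 0 < z) :
    macdonaldSeries (-ν) z = z ^ (-ν) * macdonaldSeries ν z := by
  have h : z ^ (-ν) * z ^ ν = 1 := by rw [← rpow_add hz]; simp
  simp only [macdonaldSeries, mul_neg, sin_neg, sub_neg_eq_add, ← sub_eq_add_neg, div_neg]
  linear_combination (π / sin (π * ν) * regularizedHGLimit (1 + ν) z) * h

lemma hasDerivAt_macdonaldSeries {ν : ℝ} (hν : ∀ n : ℤ, ν ≠ n) {z : ℝ} (hz : 0 < z) :
    HasDerivAt (macdonaldSeries ν) (-macdonaldSeries (ν - 1) z) z := by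
  have h := ((hasDerivAt_regularizedHGLimit (1 - ν) z).sub
    ((hasDerivAt_rpow_const (p := ν) (Or.inl hz.ne')).mul
      (hasDerivAt_regularizedHGLimit (1 + ν) z))).const_mul (π / sin (π * ν))
  refine h.congr_deriv ?_
  have hs : sin (π * (ν - 1)) = -sin (π * ν) := by
    rw [mul_sub, mul_one, sin_sub_pi]
  have hzν : z ^ ν = z ^ (ν - 1) * z := by
    rw [← rpow_add_one hz.ne', sub_add_cancel]
  simp only [macdonaldSeries, hs]
  rw [show 1 - (ν - 1) = 1 - ν + 1 by ring, show 1 + (ν - 1) = ν by ring,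
    regularizedHGLimit_eq hν z, hzν, div_neg, show 1 + ν + 1 = ν + 2 by ring, add_comm 1 ν]
  ring

lemma tendsto_macdonaldSeries {ν : ℝ} (h0 : 0 < ν) (h1 : ν < 1) :
    Tendsto (macdonaldSeries ν) (𝓝[>] 0) (𝓝 (Real.Gamma ν)) := by
  have hc : ContinuousAt (macdonaldSeries ν) 0 :=
    continuousAt_const.mul ((hasDerivAt_regularizedHGLimit (1 - ν) 0).continuousAt.sub
      ((continuousAt_rpow_const 0 ν (Or.inr h0.le)).mul
        (hasDerivAt_regularizedHGLimit (1 + ν) 0).continuousAt))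
  have hv : macdonaldSeries ν 0 = Real.Gamma ν := by
    have : Real.Gamma (1 - ν) ≠ 0 := (Real.Gamma_pos_of_pos (by linarith)).ne'
    rw [macdonaldSeries, zero_rpow h0.ne', regularizedHGLimit_zero,
      ← Real.Gamma_mul_Gamma_one_sub]
    field_simp
    ring
  exact hv ▸ hc.tendsto.mono_left nhdsWithin_le_nhds

/-- The integral `∫₀^∞ exp (-z / x - x) x ^ (ν - 1) dx`. -/
noncomputable def macdonaldIntegral (ν z : ℝ) : ℝ :=
  ∫ x in Ioi (0 : ℝ), exp (-z / x - x) * x ^ (ν - 1)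

lemma aestronglyMeasurable_macdonald (ν z : ℝ) :
    AEStronglyMeasurable (fun x : ℝ => exp (-z / x - x) * x ^ (ν - 1))
      (volume.restrict (Ioi 0)) := by
  have : Measurable (fun x : ℝ => exp (-z / x - x) * x ^ (ν - 1)) := by fun_prop
  exact this.aestronglyMeasurable

lemma integrableOn_macdonald (ν : ℝ) {z : ℝ} (hz : 0 < z) :
    IntegrableOn (fun x : ℝ => exp (-z / x - x) * x ^ (ν - 1)) (Ioi 0) := by
  obtain ⟨k, hk⟩ := exists_nat_gt (-ν)
  have hg := (Real.GammaIntegral_convergent (s := ν + k) (by linarith)).const_mul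
    (k.factorial / z ^ k : ℝ)
  refine Integrable.mono' hg (aestronglyMeasurable_macdonald ν z) ?_
  filter_upwards [ae_restrict_mem measurableSet_Ioi] with x hx
  have hx : 0 < x := hx
  rw [norm_of_nonneg (by positivity)]
  have hb : exp (-z / x) ≤ k.factorial / z ^ k * x ^ k := by
    have := Real.pow_div_factorial_le_exp (x := z / x) (by positivity) k
    rw [neg_div, exp_neg]
    refine (inv_anti₀ (by positivity) this).trans_eq ?_
    rw [div_pow]
    field_simp
  rw [sub_eq_add_neg, exp_add, show ν + k - 1 = k + (ν - 1) by ring, rpow_add hx, rpow_natCast]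
  calc _ ≤ (k.factorial / z ^ k * x ^ k) * exp (-x) * x ^ (ν - 1) := by gcongr
    _ = _ := by ring

lemma hasDerivAt_macdonaldIntegral (ν : ℝ) {z : ℝ} (hz : 0 < z) :
    HasDerivAt (macdonaldIntegral ν) (-macdonaldIntegral (ν - 1) z) z := by
  have h := (hasDerivAt_integral_of_dominated_loc_of_deriv_le
    (F := fun z x : ℝ => exp (-z / x - x) * x ^ (ν - 1))
    (F' := fun z x : ℝ => -(exp (-z / x - x) * x ^ (ν - 1 - 1)))
    (bound := fun x : ℝ => exp (-(z / 2) / x - x) * x ^ (ν - 1 - 1))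
    (μ := volume.restrict (Ioi 0))
    (Ioi_mem_nhds (half_lt_self hz))
    (.of_forall fun y => aestronglyMeasurable_macdonald ν y)
    (integrableOn_macdonald ν hz) (aestronglyMeasurable_macdonald (ν - 1) z).neg
    ?_ (integrableOn_macdonald (ν - 1) (half_pos hz)) ?_).2
  · rw [integral_neg] at h
    exact h
  · filter_upwards [ae_restrict_mem measurableSet_Ioi] with x hx y hy
    have hx : 0 < x := hx
    have hy : z / 2 < y := hy
    rw [norm_neg, norm_of_nonneg (by positivity)]
    gcongr
  · filter_upwards [ae_restrict_mem measurableSet_Ioi] with x hx y hy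
    have hx : 0 < x := hx
    have := ((((hasDerivAt_id y).neg.div_const x).sub_const x).exp).mul_const (x ^ (ν - 1))
    refine this.congr_deriv ?_
    rw [rpow_sub_one hx.ne' (ν - 1)]
    simp only [id, Pi.neg_apply]
    field_simp

lemma macdonaldIntegral_neg (ν : ℝ) {z : ℝ} (hz : 0 < z) :
    macdonaldIntegral (-ν) z = z ^ (-ν) * macdonaldIntegral ν z := by
  have h1 := integral_comp_rpow_Ioi (fun x : ℝ => exp (-z / x - x) * x ^ (-ν - 1))
    (p := -1) (by norm_num)
  have h2 := integral_comp_mul_left_Ioi' (fun x : ℝ => exp (-z / x - x) * x ^ (ν - 1)) 0 hz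
  rw [mul_zero, smul_eq_mul] at h2
  rw [macdonaldIntegral, ← h1, macdonaldIntegral, ← h2, ← integral_const_mul,
    ← integral_const_mul]
  refine setIntegral_congr_fun measurableSet_Ioi fun x hx => ?_
  have hx : 0 < x := hx
  have hexp : -z / x ^ (-1 : ℝ) - x ^ (-1 : ℝ) = -z / (z * x) - z * x := by
    rw [rpow_neg_one]
    field_simp
    ring
  have hxpow : x ^ (-1 - 1 : ℝ) * (x ^ (-1 : ℝ)) ^ (-ν - 1) = x ^ (ν - 1) := by
    rw [← rpow_mul hx.le, ← rpow_add hx]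
    congr 1
    ring
  have hzpow : z ^ (-ν) * (z * z ^ (ν - 1)) = 1 := by
    rw [mul_comm z, ← rpow_add_one hz.ne', ← rpow_add hz]
    simp
  simp only [smul_eq_mul, abs_neg, abs_one, one_mul, hexp, mul_rpow hz.le hx.le]
  linear_combination exp (-z / (z * x) - z * x) * hxpow -
    exp (-z / (z * x) - z * x) * x ^ (ν - 1) * hzpow

lemma tendsto_macdonaldIntegral {ν : ℝ} (h0 : 0 < ν) :
    Tendsto (macdonaldIntegral ν) (𝓝[>] 0) (𝓝 (Real.Gamma ν)) := by
  rw [Real.Gamma_eq_integral h0]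
  refine tendsto_integral_filter_of_dominated_convergence (fun x => exp (-x) * x ^ (ν - 1))
    (.of_forall fun y => aestronglyMeasurable_macdonald ν y) ?_
    (Real.GammaIntegral_convergent h0) ?_
  · filter_upwards [self_mem_nhdsWithin] with z hz
    filter_upwards [ae_restrict_mem measurableSet_Ioi] with x hx
    have hx : 0 < x := hx
    have hz : 0 < z := hz
    have : 0 < z / x := by positivity
    rw [norm_of_nonneg (by positivity), neg_div]
    gcongr
    linarith
  · filter_upwards [ae_restrict_mem measurableSet_Ioi] with x hx
    have : Continuous fun z : ℝ => exp (-z / x - x) * x ^ (ν - 1) := by fun_prop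
    have := (this.tendsto 0).mono_left (nhdsWithin_le_nhds (s := Ioi 0))
    simpa using this

/-- A solution of the linear system `D' = -z ^ (ν - 1) H`, `H' = -z ^ (-ν) D` that vanishes
at `0` is zero. -/
lemma eq_zero_of_hasDerivAt_system {ν : ℝ} (h0 : 0 < ν) (h1 : ν < 1) {D H : ℝ → ℝ}
    (hD : ∀ z, 0 < z → HasDerivAt D (-(z ^ (ν - 1) * H z)) z)
    (hH : ∀ z, 0 < z → HasDerivAt H (-(z ^ (-ν) * D z)) z)
    (hD0 : Tendsto D (𝓝[>] 0) (𝓝 0)) (hH0 : Tendsto H (𝓝[>] 0) (𝓝 0)) {z : ℝ} (hz : 0 < z) :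
    D z = 0 := by
  set P : ℝ → ℝ := fun z => z ^ ν / ν + z ^ (1 - ν) / (1 - ν) with hP
  have hPd : ∀ z, 0 < z → HasDerivAt P (z ^ (ν - 1) + z ^ (-ν)) z := by
    intro z hz
    have h := ((hasDerivAt_rpow_const (p := ν) (Or.inl hz.ne')).div_const ν).add
      ((hasDerivAt_rpow_const (p := 1 - ν) (Or.inl hz.ne')).div_const (1 - ν))
    refine h.congr_deriv ?_
    have : 1 - ν ≠ 0 := by linarith
    rw [mul_div_cancel_left₀ _ h0.ne', mul_div_cancel_left₀ _ this]
    congr 2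
    ring
  set Q : ℝ → ℝ := fun z => (D z ^ 2 + H z ^ 2) * exp (-P z) with hQ
  have hQd : ∀ z, 0 < z → HasDerivAt Q
      (-((z ^ (ν - 1) + z ^ (-ν)) * (D z + H z) ^ 2 * exp (-P z))) z := by
    intro z hz
    have h := (((hD z hz).pow 2).add ((hH z hz).pow 2)).mul (hPd z hz).neg.exp
    refine h.congr_deriv ?_
    simp only [Pi.add_apply, Pi.pow_apply, Pi.neg_apply]
    push_cast
    ring
  have hanti : AntitoneOn Q (Ioi 0) := by
    refine antitoneOn_of_hasDerivWithinAt_nonpos (convex_Ioi 0)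
      (fun z hz => (hQd z hz).continuousAt.continuousWithinAt)
      (fun z hz => (hQd z (interior_subset hz)).hasDerivWithinAt) fun z hz => ?_
    have hz : 0 < z := interior_subset hz
    rw [neg_nonpos]
    positivity
  have hlim : Tendsto (fun z => D z ^ 2 + H z ^ 2) (𝓝[>] 0) (𝓝 0) := by
    simpa using (hD0.pow 2).add (hH0.pow 2)
  have hQz : Q z ≤ 0 := by
    refine ge_of_tendsto hlim ?_
    filter_upwards [Ioo_mem_nhdsGT hz] with w hw
    have hw0 : 0 < w := hw.1
    refine (hanti hw0 hz hw.2.le).trans (mul_le_of_le_one_right (by positivity) ?_)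
    rw [exp_le_one_iff, neg_nonpos]
    have : 0 < 1 - ν := by linarith
    positivity
  have hsum : D z ^ 2 + H z ^ 2 ≤ 0 := nonpos_of_mul_nonpos_left hQz (exp_pos _)
  nlinarith [sq_nonneg (D z), sq_nonneg (H z)]

lemma ne_intCast_of_mem_Ioo {ν : ℝ} (h0 : 0 < ν) (h1 : ν < 1) (n : ℤ) : ν ≠ n := by
  rintro rfl
  have h0 : 0 < n := by exact_mod_cast h0
  have h1 : n < 1 := by exact_mod_cast h1
  omega

lemma macdonaldIntegral_eq_of_mem_Ioo {ν : ℝ} (h0 : 0 < ν) (h1 : ν < 1) {z : ℝ} (hz : 0 < z) :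
    macdonaldIntegral ν z = macdonaldSeries ν z := by
  have deriv_sub : ∀ μ : ℝ, 0 < μ → μ < 1 → ∀ z : ℝ, 0 < z →
      HasDerivAt (macdonaldIntegral μ - macdonaldSeries μ)
        (-(z ^ (μ - 1) * (macdonaldIntegral (1 - μ) - macdonaldSeries (1 - μ)) z)) z := by
    intro μ hμ0 hμ1 z hz
    refine ((hasDerivAt_macdonaldIntegral μ hz).sub
      (hasDerivAt_macdonaldSeries (ne_intCast_of_mem_Ioo hμ0 hμ1) hz)).congr_deriv ?_
    rw [show μ - 1 = -(1 - μ) by ring, macdonaldIntegral_neg _ hz, macdonaldSeries_neg _ hz,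
      Pi.sub_apply]
    ring
  have lim_sub : ∀ μ : ℝ, 0 < μ → μ < 1 →
      Tendsto (macdonaldIntegral μ - macdonaldSeries μ) (𝓝[>] 0) (𝓝 0) := by
    intro μ hμ0 hμ1
    simpa using! (tendsto_macdonaldIntegral hμ0).sub (tendsto_macdonaldSeries hμ0 hμ1)
  have := eq_zero_of_hasDerivAt_system h0 h1 (deriv_sub ν h0 h1)
    (fun z hz => by
      have := deriv_sub (1 - ν) (by linarith) (by linarith) z hz
      rwa [show 1 - ν - 1 = -ν by ring, sub_sub_cancel] at this)
    (lim_sub ν h0 h1) (lim_sub (1 - ν) (by linarith) (by linarith)) hz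
  exact sub_eq_zero.1 this

lemma macdonaldIntegral_sub_one_eq {ν : ℝ} (hν : ∀ n : ℤ, ν ≠ n)
    (h : ∀ z, 0 < z → macdonaldIntegral ν z = macdonaldSeries ν z) {z : ℝ} (hz : 0 < z) :
    macdonaldIntegral (ν - 1) z = macdonaldSeries (ν - 1) z := by
  have hev : macdonaldIntegral ν =ᶠ[𝓝 z] macdonaldSeries ν := by
    filter_upwards [Ioi_mem_nhds hz] with w hw using h w hw
  exact neg_injective (((hasDerivAt_macdonaldIntegral ν hz).congr_of_eventuallyEq hev.symm).unique
    (hasDerivAt_macdonaldSeries hν hz))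

lemma macdonaldIntegral_neg_eq {ν : ℝ}
    (h : ∀ z, 0 < z → macdonaldIntegral ν z = macdonaldSeries ν z) {z : ℝ} (hz : 0 < z) :
    macdonaldIntegral (-ν) z = macdonaldSeries (-ν) z := by
  rw [macdonaldIntegral_neg ν hz, macdonaldSeries_neg ν hz, h z hz]

theorem macdonaldIntegral_eq_macdonaldSeries {ν : ℝ} (hν : ∀ n : ℤ, ν ≠ n) {z : ℝ} (hz : 0 < z) :
    macdonaldIntegral ν z = macdonaldSeries ν z := by
  have hf0 : 0 < Int.fract ν := Int.fract_pos.2 (hν _)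
  have hne : ∀ k n : ℤ, Int.fract ν + k ≠ n := by
    intro k n h
    refine hν (n - k + ⌊ν⌋) ?_
    have := Int.fract_add_floor ν
    push_cast
    linarith
  have key : ∀ k : ℤ, ∀ z, 0 < z →
      macdonaldIntegral (Int.fract ν + k) z = macdonaldSeries (Int.fract ν + k) z := by
    intro k
    induction k with
    | zero =>
      intro z hz
      simpa using macdonaldIntegral_eq_of_mem_Ioo hf0 (Int.fract_lt_one ν) hz
    | succ k ih =>
      intro z hz
      have h1 := fun z (hz : 0 < z) => macdonaldIntegral_neg_eq ih hz
      have h2 := fun z (hz : 0 < z) => macdonaldIntegral_sub_one_eq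
        (fun n h => hne k (-n) (by push_cast at h ⊢; linarith)) h1 hz
      have h3 := macdonaldIntegral_neg_eq h2 hz
      convert h3 using 2 <;> push_cast <;> ring
    | pred k ih =>
      intro z hz
      have h1 := macdonaldIntegral_sub_one_eq (hne _) ih hz
      convert h1 using 2 <;> push_cast <;> ring
  have := key ⌊ν⌋ z hz
  rwa [Int.fract_add_floor] at this

lemma besselI_two_mul_sqrt (α : ℝ) {z : ℝ} (hz : 0 < z) :
    besselI α (2 * √z) = z ^ (α / 2) * regularizedHGLimit (1 + α) z := by
  rw [besselI, regularizedHGLimit, ← tsum_mul_left]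
  refine tsum_congr fun m => ?_
  rw [mul_div_cancel_left₀ _ two_ne_zero, sqrt_eq_rpow, ← rpow_mul hz.le,
    show (1 / 2 : ℝ) * (2 * m + α) = α / 2 + m by ring, rpow_add hz, rpow_natCast,
    show (m : ℝ) + α + 1 = m + (1 + α) by ring, mul_div_assoc]

lemma two_mul_besselK_two_mul_sqrt (ν : ℝ) {z : ℝ} (hz : 0 < z) :
    z ^ (ν / 2) * (2 * besselK ν (2 * √z)) = macdonaldSeries ν z := by
  have h1 : z ^ (ν / 2) * z ^ (-ν / 2) = 1 := by
    rw [← rpow_add hz, neg_div, add_neg_cancel, rpow_zero]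
  have h2 : z ^ ν = z ^ (ν / 2) * z ^ (ν / 2) := by rw [← rpow_add hz, add_halves]
  rw [besselK, macdonaldSeries, besselI_two_mul_sqrt _ hz, besselI_two_mul_sqrt _ hz, h2,
    ← sub_eq_add_neg]
  linear_combination (π / sin (π * ν) * regularizedHGLimit (1 - ν) z) * h1

lemma integral_exp_mul_rpow_eq (b A : ℝ) {u : ℝ} (hu : 0 < u) :
    ∫ x in Ioi (0 : ℝ), exp (-b / x - u * x) * x ^ A =
      u ^ (-(A + 1)) * macdonaldIntegral (A + 1) (b * u) := by
  have h := integral_comp_mul_left_Ioi'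
    (fun x : ℝ => exp (-(b * u) / x - x) * x ^ (A + 1 - 1)) 0 hu
  rw [mul_zero, smul_eq_mul] at h
  rw [macdonaldIntegral, ← h, ← integral_const_mul, ← integral_const_mul]
  refine setIntegral_congr_fun measurableSet_Ioi fun x hx => ?_
  have hx : 0 < x := hx
  have hpow : u ^ (-(A + 1)) * (u * u ^ A) = 1 := by
    rw [mul_comm u, ← rpow_add_one hu.ne', ← rpow_add hu]
    simp
  have hdiv : -(b * u) / (u * x) = -b / x := by field_simp
  simp only [hdiv, add_sub_cancel_right, mul_rpow hu.le hx.le]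
  linear_combination (-exp (-b / x - u * x) * x ^ A) * hpow

theorem integral_eq_besselK (b u A : ℝ) (hb : 0 < b) (hu : 0 < u)
    (hA : ∀ n : ℤ, A ≠ (n : ℝ)) :
    ∫ x in Set.Ioi (0:ℝ), Real.exp (-b / x - u * x) * x ^ A
      = 2 * (b / u) ^ ((A + 1) / 2) * besselK (A + 1) (2 * Real.sqrt (b * u)) := by
  have hz : 0 < b * u := mul_pos hb hu
  have hν : ∀ n : ℤ, A + 1 ≠ n := fun n h => hA (n - 1) (by push_cast; linarith)
  have hpow : (b / u) ^ ((A + 1) / 2) = u ^ (-(A + 1)) * (b * u) ^ ((A + 1) / 2) := by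
    rw [div_rpow hb.le hu.le, mul_rpow hb.le hu.le, ← mul_assoc, mul_right_comm,
      ← rpow_add hu, div_eq_mul_inv, ← rpow_neg hu.le, mul_comm]
    congr 2
    ring
  rw [integral_exp_mul_rpow_eq b A hu, macdonaldIntegral_eq_macdonaldSeries hν hz,
    ← two_mul_besselK_two_mul_sqrt _ hz, hpow]
  ring
end

section
/- For every positive integer n and b > 0, ∫₀^∞ e^{x - b/x} x^{n - 3/2} Γ(1 - n, x) dx = (π b^{n/2 - 1/4} / (n-1)!) · [J'_{n-1/2}(2√b) − (−1)^n H'_{1/2−n}(2√b) − (−1)^n π J_{1/2−n}(2√b)], where Γ(p, x) is the upper incomplete Gamma function, J_α the Bessel function of the first kind, H_α the Struve function, and the primes denote derivatives with respect to the order. -/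
open MeasureTheory Real Set

/-- Bessel function of the first kind of order `α`. -/
noncomputable def besselJ (α z : ℝ) : ℝ :=
  ∑' n : ℕ, (-1) ^ n / ((n.factorial : ℝ) * Real.Gamma ((n : ℝ) + α + 1)) *
    (z / 2) ^ (2 * (n : ℝ) + α)

/-- Struve function of order `α`. -/
noncomputable def struveH (α z : ℝ) : ℝ :=
  ∑' n : ℕ, (-1) ^ n / (Real.Gamma ((n : ℝ) + 3 / 2) * Real.Gamma ((n : ℝ) + α + 3 / 2)) *
    (z / 2) ^ (2 * (n : ℝ) + α + 1)

noncomputable def rGamma (s : ℝ) : ℝ := (Real.Gamma s)⁻¹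

theorem rGamma_eq_re (s : ℝ) : rGamma s = ((Complex.Gamma (s : ℂ))⁻¹).re := by
  rw [Complex.Gamma_ofReal, ← Complex.ofReal_inv, Complex.ofReal_re]; rfl

theorem rGamma_eq_mul (s : ℝ) : rGamma s = s * rGamma (s + 1) := by
  have h := Complex.one_div_Gamma_eq_self_mul_one_div_Gamma_add_one (s : ℂ)
  have h2 : ((rGamma s : ℝ) : ℂ) = ((s * rGamma (s + 1) : ℝ) : ℂ) := by
    simp only [rGamma]
    push_cast
    rw [← Complex.Gamma_ofReal, ← Complex.Gamma_ofReal]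
    simpa using h
  exact_mod_cast h2

theorem hasDerivAt_rGamma_re (s : ℝ) :
    HasDerivAt rGamma (deriv (fun z : ℂ => (Complex.Gamma z)⁻¹) (s : ℂ)).re s := by
  have h := (Complex.differentiable_one_div_Gamma (s : ℂ)).hasDerivAt.real_of_complex
  have e : rGamma = fun x : ℝ => ((Complex.Gamma (x : ℂ))⁻¹).re := funext rGamma_eq_re
  rw [e]; exact h

theorem hasDerivAt_rGamma (s : ℝ) : HasDerivAt rGamma (deriv rGamma s) s :=
  (hasDerivAt_rGamma_re s).differentiableAt.hasDerivAt

theorem continuous_rGamma : Continuous rGamma :=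
  continuous_iff_continuousAt.2 fun s => (hasDerivAt_rGamma s).continuousAt

theorem continuous_deriv_rGamma : Continuous (deriv rGamma) := by
  have e : deriv rGamma
      = fun s : ℝ => (deriv (fun z : ℂ => (Complex.Gamma z)⁻¹) (s : ℂ)).re :=
    funext fun s => (hasDerivAt_rGamma_re s).deriv
  rw [e]
  have h : Continuous (deriv (fun z : ℂ => (Complex.Gamma z)⁻¹)) :=
    (Complex.differentiable_one_div_Gamma.contDiff (n := 1)).continuous_deriv le_rfl
  fun_prop

theorem deriv_rGamma_eq (s : ℝ) :
    deriv rGamma s = rGamma (s + 1) + s * deriv rGamma (s + 1) := by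
  have h := (hasDerivAt_id s).mul ((hasDerivAt_rGamma (s + 1)).comp_add_const s 1)
  have e : rGamma = fun s => s * rGamma (s + 1) := funext rGamma_eq_mul
  have h2 : deriv (fun s => s * rGamma (s + 1)) s = _ := h.deriv
  rw [← e] at h2
  simpa using h2

theorem rGamma_neg_nat (k : ℕ) : rGamma (-(k : ℝ)) = 0 := by
  simp [rGamma, Real.Gamma_neg_nat_eq_zero]

theorem deriv_rGamma_one : deriv rGamma 1 = eulerMascheroniConstant := by
  have h := Real.hasDerivAt_Gamma_one.inv (by simp)
  have h2 : deriv rGamma 1 = _ := h.deriv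
  simpa using h2

theorem rGamma_one_half : rGamma (1/2) = 1 / √π := by
  rw [rGamma, Real.Gamma_one_half_eq, one_div]

theorem deriv_rGamma_one_half :
    deriv rGamma (1/2) = (eulerMascheroniConstant + 2 * Real.log 2) / √π := by
  have h := Real.hasDerivAt_Gamma_one_half.inv (by rw [Real.Gamma_one_half_eq]; positivity)
  have h2 : deriv rGamma (1/2) = _ := h.deriv
  rw [h2, Real.Gamma_one_half_eq, Real.sq_sqrt pi_pos.le]
  have : √π * √π = π := Real.mul_self_sqrt pi_pos.le
  field_simp
  linear_combination (eulerMascheroniConstant + 2 * Real.log 2) * this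

/-- Coefficient sequences of everywhere convergent power series. -/
def IsEntireSeq (c : ℕ → ℝ) : Prop := ∀ r : ℝ, 0 ≤ r → Summable fun k => |c k| * r ^ k

theorem IsEntireSeq.mono {c d : ℕ → ℝ} (hd : IsEntireSeq d) (C : ℝ)
    (h : ∀ k, |c k| ≤ C * |d k|) : IsEntireSeq c := fun r hr => by
  refine Summable.of_nonneg_of_le (fun k => by positivity) (fun k => ?_) ((hd r hr).mul_left C)
  rw [← mul_assoc]
  exact mul_le_mul_of_nonneg_right (h k) (by positivity)

theorem IsEntireSeq.add {c d : ℕ → ℝ} (hc : IsEntireSeq c) (hd : IsEntireSeq d) :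
    IsEntireSeq fun k => c k + d k := fun r hr => by
  refine Summable.of_nonneg_of_le (fun k => by positivity) (fun k => ?_)
    ((hc r hr).add (hd r hr))
  rw [← add_mul]
  exact mul_le_mul_of_nonneg_right (abs_add_le _ _) (by positivity)

theorem IsEntireSeq.const_mul {c : ℕ → ℝ} (hc : IsEntireSeq c) (a : ℝ) :
    IsEntireSeq fun k => a * c k :=
  hc.mono |a| fun _ => (abs_mul _ _).le

theorem IsEntireSeq.nat_mul {c : ℕ → ℝ} (hc : IsEntireSeq c) :
    IsEntireSeq fun k => (k : ℝ) * c k := fun r hr => by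
  refine Summable.of_nonneg_of_le (fun k => by positivity) (fun k => ?_)
    (hc (2 * r) (by positivity))
  rw [abs_mul, Nat.abs_cast, mul_pow]
  have : (k : ℝ) ≤ 2 ^ k := by exact_mod_cast Nat.lt_two_pow_self.le
  calc (k : ℝ) * |c k| * r ^ k = k * (|c k| * r ^ k) := by ring
    _ ≤ 2 ^ k * (|c k| * r ^ k) := by gcongr
    _ = _ := by ring

theorem IsEntireSeq.mul {c d : ℕ → ℝ} (hc : IsEntireSeq c) (hd : IsEntireSeq d) :
    IsEntireSeq fun k => c k * d k := by
  have h := (hd 1 zero_le_one)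
  simp only [one_pow, mul_one] at h
  refine hc.mono (∑' k, |d k|) fun k => ?_
  rw [abs_mul, mul_comm]
  exact mul_le_mul_of_nonneg_right (h.le_tsum k fun j _ => abs_nonneg _) (abs_nonneg _)

theorem IsEntireSeq.summable {c : ℕ → ℝ} (hc : IsEntireSeq c) (x : ℝ) :
    Summable fun k => c k * x ^ k := by
  refine Summable.of_norm ?_
  simpa [abs_mul] using hc |x| (abs_nonneg x)

theorem exists_isEntireSeq_bound_rGamma (M : ℕ) :
    ∃ D : ℕ → ℝ, IsEntireSeq D ∧ ∀ s : ℝ, |s| ≤ M → ∀ k : ℕ,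
      |rGamma (k + s)| ≤ D k ∧ |deriv rGamma (k + s)| ≤ D k := by
  have hK : IsCompact (Icc (-(M : ℝ)) M) := isCompact_Icc
  have hne : (Icc (-(M : ℝ)) M).Nonempty := ⟨0, by simp⟩
  have hcont : ∀ k : ℕ, ContinuousOn
      (fun s : ℝ => |rGamma (k + s)| + |deriv rGamma (k + s)|) (Icc (-(M : ℝ)) M) := by
    intro k
    have h1 := continuous_rGamma
    have h2 := continuous_deriv_rGamma
    exact Continuous.continuousOn (by fun_prop)
  choose t htM htmax using fun k => hK.exists_isMaxOn hne (hcont k)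
  set D : ℕ → ℝ := fun k => |rGamma (k + t k)| + |deriv rGamma (k + t k)| with hD
  have hD0 : ∀ k, 0 ≤ D k := fun k => by positivity
  have hle : ∀ s : ℝ, |s| ≤ M → ∀ k : ℕ,
      |rGamma (k + s)| + |deriv rGamma (k + s)| ≤ D k := fun s hs k =>
    htmax k (abs_le.1 hs)
  refine ⟨D, ?_, fun s hs k => ?_⟩
  · intro r hr
    obtain ⟨N, hN⟩ := exists_nat_ge (M + 1 + 4 * r)
    refine summable_of_ratio_norm_eventually_le (r := 1 / 2) (by norm_num) ?_
    filter_upwards [Filter.eventually_ge_atTop N] with k hk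
    have hk' : (N : ℝ) ≤ k := by exact_mod_cast hk
    have ht := abs_le.1 (show |t (k + 1)| ≤ M from abs_le.2 (htM (k + 1)))
    set q : ℝ := k + t (k + 1) with hq
    have hq1 : 1 ≤ q := by linarith
    have hq4 : 4 * r ≤ q := by linarith
    have e : ((k + 1 : ℕ) : ℝ) + t (k + 1) = q + 1 := by push_cast; ring
    have h1 := rGamma_eq_mul q
    have h2 := deriv_rGamma_eq q
    have h3 := hle (t (k + 1)) (abs_le.2 (htM (k + 1))) k
    have a1 : q * |rGamma (q + 1)| = |rGamma q| := by
      rw [h1, abs_mul, abs_of_pos (show 0 < q by linarith)]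
    have a2 : q * |deriv rGamma (q + 1)| ≤ |deriv rGamma q| + |rGamma (q + 1)| := by
      have : q * deriv rGamma (q + 1) = deriv rGamma q - rGamma (q + 1) := by linarith
      rw [← abs_of_pos (show 0 < q by linarith), ← abs_mul, abs_of_pos (show 0 < q by linarith),
        this]
      exact abs_sub _ _
    have a3 : q * D (k + 1) ≤ 2 * D k := by
      have : D (k + 1) = |rGamma (q + 1)| + |deriv rGamma (q + 1)| := by
        simp only [hD, e]
      rw [this]
      have : |rGamma (q + 1)| ≤ q * |rGamma (q + 1)| :=
        le_mul_of_one_le_left (abs_nonneg _) hq1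
      have := abs_nonneg (deriv rGamma q)
      rw [← hq] at h3
      linarith
    have a4 : r * D (k + 1) ≤ 1 / 2 * D k := by
      have := mul_le_mul_of_nonneg_right hq4 (hD0 (k + 1))
      linarith
    rw [Real.norm_of_nonneg (by positivity), Real.norm_of_nonneg (by positivity),
      abs_of_nonneg (hD0 _), abs_of_nonneg (hD0 _), pow_succ]
    calc D (k + 1) * (r ^ k * r) = r ^ k * (r * D (k + 1)) := by ring
      _ ≤ r ^ k * (1 / 2 * D k) := by gcongr
      _ = _ := by ring
  · have := hle s hs k
    constructor <;> linarith [abs_nonneg (rGamma (k + s)), abs_nonneg (deriv rGamma (k + s))]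

theorem isEntireSeq_rGamma (s : ℝ) : IsEntireSeq fun k => rGamma (k + s) := by
  obtain ⟨M, hM⟩ := exists_nat_ge |s|
  obtain ⟨D, hD, h⟩ := exists_isEntireSeq_bound_rGamma M
  exact hD.mono 1 fun k => by
    rw [one_mul]; exact (h s hM k).1.trans (le_abs_self _)

theorem isEntireSeq_deriv_rGamma (s : ℝ) : IsEntireSeq fun k => deriv rGamma (k + s) := by
  obtain ⟨M, hM⟩ := exists_nat_ge |s|
  obtain ⟨D, hD, h⟩ := exists_isEntireSeq_bound_rGamma M
  exact hD.mono 1 fun k => by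
    rw [one_mul]; exact (h s hM k).2.trans (le_abs_self _)

/-- The sum of the power series with coefficients `c`. -/
noncomputable def powerSum (c : ℕ → ℝ) (x : ℝ) : ℝ := ∑' k, c k * x ^ k

theorem powerSum_zero (x : ℝ) : powerSum (fun _ => 0) x = 0 := by simp [powerSum]

theorem powerSum_add {c d : ℕ → ℝ} (hc : IsEntireSeq c) (hd : IsEntireSeq d) (x : ℝ) :
    powerSum (fun k => c k + d k) x = powerSum c x + powerSum d x := by
  simp only [powerSum, add_mul]
  exact (hc.summable x).tsum_add (hd.summable x)

theorem powerSum_const_mul (a : ℝ) (c : ℕ → ℝ) (x : ℝ) :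
    powerSum (fun k => a * c k) x = a * powerSum c x := by
  simp only [powerSum, mul_assoc, tsum_mul_left]

theorem powerSum_eq_pow_mul {c : ℕ → ℝ} (hc : IsEntireSeq c) (N : ℕ) (h : ∀ k < N, c k = 0)
    (x : ℝ) : powerSum c x = x ^ N * powerSum (fun k => c (k + N)) x := by
  rw [powerSum, ← (hc.summable x).sum_add_tsum_nat_add N, Finset.sum_eq_zero, zero_add, powerSum,
    ← tsum_mul_left]
  · exact tsum_congr fun k => by ring
  · intro k hk
    rw [h k (Finset.mem_range.1 hk), zero_mul]

theorem powerSum_at_zero (c : ℕ → ℝ) : powerSum c 0 = c 0 := by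
  rw [powerSum, tsum_eq_single 0 fun k hk => by simp [hk]]
  simp

theorem exists_hasDerivAt_powerSum {c : ℕ → ℝ} (hc : IsEntireSeq c) (x : ℝ) :
    ∃ D, HasDerivAt (powerSum c) D x ∧ x * D = powerSum (fun k => (k : ℝ) * c k) x := by
  set R : ℝ := |x| + 1 with hR
  have hR1 : 1 ≤ R := by have := abs_nonneg x; linarith
  have hu : Summable fun k : ℕ => |(k : ℝ) * c k| * R ^ k := hc.nat_mul R (by linarith)
  refine ⟨∑' k, c k * (k * x ^ (k - 1)), ?_, ?_⟩
  · refine hasDerivAt_tsum_of_isPreconnected hu (Metric.isOpen_ball (x := (0 : ℝ)) (ε := R))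
      (convex_ball _ _).isPreconnected (fun k y _ => (hasDerivAt_pow k y).const_mul (c k))
      (fun k y hy => ?_) (y₀ := x) ?_ (hc.summable x) ?_
    · have hy' : |y| ≤ R := by simpa using (Metric.mem_ball.1 hy).le
      rw [Real.norm_eq_abs, abs_mul, abs_mul, abs_mul, abs_pow]
      calc |c k| * (|(k : ℝ)| * |y| ^ (k - 1)) = |(k : ℝ)| * |c k| * |y| ^ (k - 1) := by ring
        _ ≤ |(k : ℝ)| * |c k| * R ^ (k - 1) := by gcongr
        _ ≤ |(k : ℝ)| * |c k| * R ^ k := by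
          refine mul_le_mul_of_nonneg_left ?_ (by positivity)
          exact pow_le_pow_right₀ hR1 (Nat.sub_le k 1)
    · simp [hR]
    · simp [hR]
  · rw [powerSum, ← tsum_mul_left]
    refine tsum_congr fun k => ?_
    rcases k with _ | k
    · simp
    · simp only [Nat.add_sub_cancel]; ring

theorem continuous_powerSum {c : ℕ → ℝ} (hc : IsEntireSeq c) : Continuous (powerSum c) :=
  continuous_iff_continuousAt.2 fun x =>
    (exists_hasDerivAt_powerSum hc x).choose_spec.1.continuousAt

/-- The logarithmic series `∑ (c k + d k * log u) * u ^ (2 * k + m)`. -/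
noncomputable def logSeries (m : ℕ) (c d : ℕ → ℝ) (u : ℝ) : ℝ :=
  u ^ m * (powerSum c (u ^ 2) + Real.log u * powerSum d (u ^ 2))

theorem hasDerivAt_logSeries (m : ℕ) {c d : ℕ → ℝ} (hc : IsEntireSeq c) (hd : IsEntireSeq d)
    {u : ℝ} (hu : 0 < u) :
    HasDerivAt (logSeries m c d)
      (logSeries m (fun k => 2 * (k * c k) + (m * c k + d k))
        (fun k => 2 * (k * d k) + m * d k) u / u) u := by
  obtain ⟨C, hC, hC'⟩ := exists_hasDerivAt_powerSum hc (u ^ 2)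
  obtain ⟨D, hD, hD'⟩ := exists_hasDerivAt_powerSum hd (u ^ 2)
  have hsq : HasDerivAt (fun u : ℝ => u ^ 2) (2 * u) u := by simpa using hasDerivAt_pow 2 u
  have h := (hasDerivAt_pow m u).mul
    ((hC.comp (h := fun u => u ^ 2) u hsq).add
      ((Real.hasDerivAt_log hu.ne').mul (hD.comp (h := fun u => u ^ 2) u hsq)))
  refine h.congr_deriv ?_
  rw [logSeries, powerSum_add (hc.nat_mul.const_mul 2) ((hc.const_mul m).add hd),
    powerSum_add (hc.const_mul m) hd, powerSum_add (hd.nat_mul.const_mul 2) (hd.const_mul m)]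
  simp only [powerSum_const_mul, ← hC', ← hD', Pi.add_apply, Pi.mul_apply, Function.comp]
  rcases m with _ | m
  · field_simp
    simp
    ring
  · simp only [Nat.add_sub_cancel]
    field_simp
    push_cast
    ring

/-- Coefficients `(-1) ^ k / (Γ(k + s) Γ(k + t))`. -/
noncomputable def coeffGamma (s t : ℝ) (k : ℕ) : ℝ := (-1) ^ k * (rGamma (k + s) * rGamma (k + t))

/-- The derivative of `coeffGamma s t k` with respect to `t`. -/
noncomputable def coeffDeriv (s t : ℝ) (k : ℕ) : ℝ :=
  (-1) ^ k * (rGamma (k + s) * deriv rGamma (k + t))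

theorem isEntireSeq_coeffGamma (s t : ℝ) : IsEntireSeq (coeffGamma s t) :=
  ((isEntireSeq_rGamma s).mul (isEntireSeq_rGamma t)).mono 1 fun k => by
    simp [coeffGamma, abs_mul]

theorem isEntireSeq_coeffDeriv (s t : ℝ) : IsEntireSeq (coeffDeriv s t) :=
  ((isEntireSeq_rGamma s).mul (isEntireSeq_deriv_rGamma t)).mono 1 fun k => by
    simp [coeffDeriv, abs_mul]

/-- The Bessel–Struve combination of order `N + 1 / 2`, as a function of half the argument. -/
noncomputable def besselStruve (N : ℕ) (u : ℝ) : ℝ :=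
  logSeries (2 * N + 1) (coeffDeriv 1 (N + 3 / 2)) (coeffGamma 1 (N + 3 / 2)) u
    + (-1) ^ N * logSeries 1 (coeffDeriv (3 / 2) (1 - N)) (coeffGamma (3 / 2) (1 - N)) u
    + (-1) ^ N * π * logSeries 0 (coeffGamma 1 (1 / 2 - N)) (fun _ => 0) u

/-- The image of `besselStruve N` under the Euler operator `u * d/du`. -/
noncomputable def eulerBesselStruve (N : ℕ) (u : ℝ) : ℝ :=
  logSeries (2 * N + 1)
      (fun k => 2 * (k * coeffDeriv 1 (N + 3 / 2) k)
        + ((2 * N + 1 : ℕ) * coeffDeriv 1 (N + 3 / 2) k + coeffGamma 1 (N + 3 / 2) k))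
      (fun k => 2 * (k * coeffGamma 1 (N + 3 / 2) k)
        + (2 * N + 1 : ℕ) * coeffGamma 1 (N + 3 / 2) k) u
    + (-1) ^ N * logSeries 1
      (fun k => 2 * (k * coeffDeriv (3 / 2) (1 - N) k)
        + ((1 : ℕ) * coeffDeriv (3 / 2) (1 - N) k + coeffGamma (3 / 2) (1 - N) k))
      (fun k => 2 * (k * coeffGamma (3 / 2) (1 - N) k)
        + (1 : ℕ) * coeffGamma (3 / 2) (1 - N) k) u
    + (-1) ^ N * π * logSeries 0
      (fun k => 2 * (k * coeffGamma 1 (1 / 2 - N) k)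
        + ((0 : ℕ) * coeffGamma 1 (1 / 2 - N) k + 0))
      (fun k => 2 * (k * 0) + (0 : ℕ) * 0) u

theorem isEntireSeq_zero : IsEntireSeq fun _ => 0 := fun r _ => by simp

theorem hasDerivAt_besselStruve (N : ℕ) {u : ℝ} (hu : 0 < u) :
    HasDerivAt (besselStruve N) (eulerBesselStruve N u / u) u := by
  have h1 := hasDerivAt_logSeries (2 * N + 1) (isEntireSeq_coeffDeriv 1 (N + 3 / 2))
    (isEntireSeq_coeffGamma 1 (N + 3 / 2)) hu
  have h2 := hasDerivAt_logSeries 1 (isEntireSeq_coeffDeriv (3 / 2) (1 - N))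
    (isEntireSeq_coeffGamma (3 / 2) (1 - N)) hu
  have h3 := hasDerivAt_logSeries 0 (isEntireSeq_coeffGamma 1 (1 / 2 - N)) isEntireSeq_zero hu
  refine ((h1.add (h2.const_mul ((-1) ^ N))).add (h3.const_mul ((-1) ^ N * π))).congr_deriv ?_
  rw [eulerBesselStruve]
  ring

theorem besselStruve_succ (N : ℕ) (u : ℝ) :
    2 * besselStruve (N + 1) u = (2 * N + 1) * besselStruve N u - eulerBesselStruve N u := by
  have eD := isEntireSeq_coeffDeriv
  have eG := isEntireSeq_coeffGamma
  set x : ℝ := u ^ 2 with hx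
  have b0 : ∀ k : ℕ, ((k + 1 : ℕ) : ℝ) * rGamma ((k + 1 : ℕ) + 1) = rGamma (k + 1) := fun k => by
    rw [rGamma_eq_mul (k + 1)]; push_cast; ring
  have b1 : powerSum (fun k => (k : ℝ) * coeffDeriv 1 (N + 3 / 2) k) x
      = - (x * powerSum (coeffDeriv 1 ((N + 1 : ℕ) + 3 / 2)) x) := by
    rw [powerSum_eq_pow_mul (eD _ _).nat_mul 1 (by simp), pow_one, neg_eq_neg_one_mul,
      mul_left_comm, ← powerSum_const_mul (-1)]
    congr 2
    ext k
    have e : ((k + 1 : ℕ) : ℝ) + (N + 3 / 2) = k + ((N + 1 : ℕ) + 3 / 2) := by push_cast; ring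
    rw [coeffDeriv, coeffDeriv, e, ← b0 k]
    ring
  have b2 : powerSum (fun k => (k : ℝ) * coeffGamma 1 (N + 3 / 2) k) x
      = - (x * powerSum (coeffGamma 1 ((N + 1 : ℕ) + 3 / 2)) x) := by
    rw [powerSum_eq_pow_mul (eG _ _).nat_mul 1 (by simp), pow_one, neg_eq_neg_one_mul,
      mul_left_comm, ← powerSum_const_mul (-1)]
    congr 2
    ext k
    have e : ((k + 1 : ℕ) : ℝ) + (N + 3 / 2) = k + ((N + 1 : ℕ) + 3 / 2) := by push_cast; ring
    rw [coeffGamma, coeffGamma, e, ← b0 k]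
    ring
  -- Struve part
  have s1 : powerSum (fun k => (k : ℝ) * coeffDeriv (3 / 2) (1 - N) k) x
      = powerSum (coeffDeriv (3 / 2) (1 - (N + 1 : ℕ))) x
        + N * powerSum (coeffDeriv (3 / 2) (1 - N)) x
        + -1 * powerSum (coeffGamma (3 / 2) (1 - N)) x := by
    rw [← powerSum_const_mul, ← powerSum_const_mul, ← powerSum_add (eD _ _) ((eD _ _).const_mul _),
      ← powerSum_add ((eD _ _).add ((eD _ _).const_mul _)) ((eG _ _).const_mul _)]
    congr 1
    ext k
    have e : (k : ℝ) + (1 - (N + 1 : ℕ)) = k - N := by push_cast; ring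
    have e' : (k : ℝ) + (1 - N) = k - N + 1 := by ring
    rw [coeffDeriv, coeffDeriv, coeffGamma, e, e', deriv_rGamma_eq (k - N)]
    ring
  have s2 : powerSum (fun k => (k : ℝ) * coeffGamma (3 / 2) (1 - N) k) x
      = powerSum (coeffGamma (3 / 2) (1 - (N + 1 : ℕ))) x
        + N * powerSum (coeffGamma (3 / 2) (1 - N)) x := by
    rw [← powerSum_const_mul, ← powerSum_add (eG _ _) ((eG _ _).const_mul _)]
    congr 1
    ext k
    have e : (k : ℝ) + (1 - (N + 1 : ℕ)) = k - N := by push_cast; ring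
    have e' : (k : ℝ) + (1 - N) = k - N + 1 := by ring
    rw [coeffGamma, coeffGamma, e, e', rGamma_eq_mul (k - N)]
    ring
  -- the non-differentiated Bessel part
  have j1 : powerSum (fun k => (k : ℝ) * coeffGamma 1 (1 / 2 - N) k) x
      = powerSum (coeffGamma 1 (1 / 2 - (N + 1 : ℕ))) x
        + (N + 1 / 2) * powerSum (coeffGamma 1 (1 / 2 - N)) x := by
    rw [← powerSum_const_mul, ← powerSum_add (eG _ _) ((eG _ _).const_mul _)]
    congr 1
    ext k
    have e : (k : ℝ) + (1 / 2 - (N + 1 : ℕ)) = k - N - 1 / 2 := by push_cast; ring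
    have e' : (k : ℝ) + (1 / 2 - N) = k - N - 1 / 2 + 1 := by ring
    rw [coeffGamma, coeffGamma, e, e', rGamma_eq_mul (k - N - 1 / 2)]
    ring
  have m1 : powerSum (coeffGamma (3 / 2) (1 - N)) x
      = (-1) ^ N * (x ^ N * powerSum (coeffGamma 1 (N + 3 / 2)) x) := by
    rw [powerSum_eq_pow_mul (eG _ _) N, mul_left_comm,
      ← powerSum_const_mul ((-1) ^ N)]
    · congr 2
      ext k
      have e : ((k + N : ℕ) : ℝ) + 3 / 2 = k + (N + 3 / 2) := by push_cast; ring
      have e' : ((k + N : ℕ) : ℝ) + (1 - N) = k + 1 := by push_cast; ring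
      rw [coeffGamma, coeffGamma, e, e']
      ring
    · intro k hk
      obtain ⟨j, rfl⟩ := Nat.exists_eq_add_of_lt hk
      have e : (k : ℝ) + (1 - (k + j + 1 : ℕ)) = -(j : ℝ) := by push_cast; ring
      rw [coeffGamma, e, rGamma_neg_nat]
      ring
  have hs : ((-1 : ℝ) ^ N) * (-1) ^ N = 1 := by rw [← mul_pow]; simp
  simp only [besselStruve, eulerBesselStruve, logSeries]
  rw [powerSum_add ((eD _ _).nat_mul.const_mul 2) (((eD _ _).const_mul _).add (eG _ _)),
    powerSum_add ((eD _ _).const_mul _) (eG _ _),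
    powerSum_add ((eG _ _).nat_mul.const_mul 2) ((eG _ _).const_mul _),
    powerSum_add ((eD _ _).nat_mul.const_mul 2) (((eD _ _).const_mul _).add (eG _ _)),
    powerSum_add ((eD _ _).const_mul _) (eG _ _),
    powerSum_add ((eG _ _).nat_mul.const_mul 2) ((eG _ _).const_mul _)]
  simp only [powerSum_const_mul, ← hx, b1, b2, s1, s2, mul_zero, add_zero, powerSum_zero,
    Nat.cast_zero, zero_mul, j1]
  simp only [m1]
  have hxN : u ^ (2 * N + 1) = u * x ^ N := by rw [hx]; ring
  have hxN' : u ^ (2 * (N + 1) + 1) = u * x ^ N * x := by rw [hx]; ring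
  rw [hxN, hxN', pow_succ (-1 : ℝ) N]
  push_cast
  linear_combination (-u * x ^ N * powerSum (coeffGamma 1 (N + 3 / 2)) x) * hs

theorem hasDerivAt_powerSum_coeffGamma (s t x : ℝ) :
    HasDerivAt (fun t => powerSum (coeffGamma s t) x) (powerSum (coeffDeriv s t) x) t := by
  obtain ⟨M, hM⟩ := exists_nat_gt |t|
  obtain ⟨D, hD, h⟩ := exists_isEntireSeq_bound_rGamma M
  have hu : Summable fun k : ℕ => |rGamma (k + s) * D k| * |x| ^ k :=
    (isEntireSeq_rGamma s).mul hD |x| (abs_nonneg x)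
  refine hasDerivAt_tsum_of_isPreconnected (g := fun k t => coeffGamma s t k * x ^ k)
    (g' := fun k t => coeffDeriv s t k * x ^ k) hu (Metric.isOpen_ball (x := (0 : ℝ)) (ε := M))
    (convex_ball _ _).isPreconnected (fun k y _ => ?_) (fun k y hy => ?_) (y₀ := t) ?_
    ((isEntireSeq_coeffGamma s t).summable x) ?_
  · exact ((((hasDerivAt_rGamma (k + y)).comp_const_add (k : ℝ) y).const_mul
      (rGamma (k + s))).const_mul ((-1) ^ k)).mul_const (x ^ k)
  · have hy' : |y| ≤ M := by simpa using (Metric.mem_ball.1 hy).le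
    have hb := (h y hy' k).2
    simp only [coeffDeriv]
    rw [Real.norm_eq_abs, abs_mul, abs_mul, abs_mul, abs_mul, abs_pow, abs_pow, abs_neg, abs_one,
      one_pow, one_mul]
    have := hb.trans (le_abs_self _)
    exact mul_le_mul_of_nonneg_right (mul_le_mul_of_nonneg_left this (abs_nonneg _))
      (by positivity)
  · simpa using hM
  · simpa using hM

theorem besselJ_two_mul (α : ℝ) {u : ℝ} (hu : 0 < u) :
    besselJ α (2 * u) = u ^ α * powerSum (coeffGamma 1 (α + 1)) (u ^ 2) := by
  rw [besselJ, powerSum, ← tsum_mul_left]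
  refine tsum_congr fun k => ?_
  have e : 2 * u / 2 = u := by ring
  have e2 : u ^ (2 * (k : ℝ)) = (u ^ 2) ^ k := by
    rw [← pow_mul, ← Real.rpow_natCast u (2 * k)]; push_cast; rfl
  rw [e, Real.rpow_add hu, coeffGamma, rGamma, rGamma, Real.Gamma_nat_eq_factorial, e2,
    ← add_assoc, div_eq_mul_inv, mul_inv]
  ring

theorem struveH_two_mul (α : ℝ) {u : ℝ} (hu : 0 < u) :
    struveH α (2 * u) = u ^ (α + 1) * powerSum (coeffGamma (3 / 2) (α + 3 / 2)) (u ^ 2) := by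
  rw [struveH, powerSum, ← tsum_mul_left]
  refine tsum_congr fun k => ?_
  have e : 2 * u / 2 = u := by ring
  have e2 : u ^ (2 * (k : ℝ)) = (u ^ 2) ^ k := by
    rw [← pow_mul, ← Real.rpow_natCast u (2 * k)]; push_cast; rfl
  rw [e, add_assoc _ α 1, Real.rpow_add hu, coeffGamma, rGamma, rGamma, e2,
    ← add_assoc, div_eq_mul_inv, mul_inv]
  ring

theorem deriv_besselJ (α : ℝ) {u : ℝ} (hu : 0 < u) :
    deriv (fun α => besselJ α (2 * u)) α = u ^ α * (powerSum (coeffDeriv 1 (α + 1)) (u ^ 2)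
      + Real.log u * powerSum (coeffGamma 1 (α + 1)) (u ^ 2)) := by
  rw [funext fun α => besselJ_two_mul α hu]
  have h := (Real.hasStrictDerivAt_const_rpow hu α).hasDerivAt.mul
    ((hasDerivAt_powerSum_coeffGamma 1 (α + 1) (u ^ 2)).comp_add_const α 1)
  refine h.deriv.trans ?_
  ring

theorem deriv_struveH (α : ℝ) {u : ℝ} (hu : 0 < u) :
    deriv (fun α => struveH α (2 * u)) α
      = u ^ (α + 1) * (powerSum (coeffDeriv (3 / 2) (α + 3 / 2)) (u ^ 2)
        + Real.log u * powerSum (coeffGamma (3 / 2) (α + 3 / 2)) (u ^ 2)) := by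
  rw [funext fun α => struveH_two_mul α hu]
  have h := ((Real.hasStrictDerivAt_const_rpow hu (α + 1)).hasDerivAt.comp_add_const α 1).mul
    ((hasDerivAt_powerSum_coeffGamma (3 / 2) (α + 3 / 2) (u ^ 2)).comp_add_const α (3 / 2))
  refine h.deriv.trans ?_
  ring

theorem besselStruve_eq (N : ℕ) {u : ℝ} (hu : 0 < u) :
    besselStruve N u = u ^ ((N : ℝ) + 1 / 2) *
      (deriv (fun α => besselJ α (2 * u)) ((N : ℝ) + 1 / 2)
        + (-1) ^ N * deriv (fun α => struveH α (2 * u)) (-1 / 2 - (N : ℝ))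
        + (-1) ^ N * π * besselJ (-1 / 2 - (N : ℝ)) (2 * u)) := by
  rw [deriv_besselJ _ hu, deriv_struveH _ hu, besselJ_two_mul _ hu]
  have e1 : (N : ℝ) + 1 / 2 + 1 = N + 3 / 2 := by ring
  have e2 : -1 / 2 - (N : ℝ) + 3 / 2 = 1 - N := by ring
  have e3 : -1 / 2 - (N : ℝ) + 1 = 1 / 2 - N := by ring
  rw [e1, e2, e3]
  have p1 : u ^ ((N : ℝ) + 1 / 2) * u ^ ((N : ℝ) + 1 / 2) = u ^ (2 * N + 1) := by
    rw [← Real.rpow_add hu, ← Real.rpow_natCast]; congr 1; push_cast; ring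
  have p2 : u ^ ((N : ℝ) + 1 / 2) * u ^ (1 / 2 - (N : ℝ)) = u := by
    rw [← Real.rpow_add hu]; ring_nf; simp
  have p3 : u ^ ((N : ℝ) + 1 / 2) * u ^ (-1 / 2 - (N : ℝ)) = 1 := by
    rw [← Real.rpow_add hu]; ring_nf; simp
  simp only [besselStruve, logSeries, powerSum_zero, mul_zero, add_zero, pow_zero, pow_one, one_mul]
  linear_combination
    -(powerSum (coeffDeriv 1 (N + 3 / 2)) (u ^ 2)
      + Real.log u * powerSum (coeffGamma 1 (N + 3 / 2)) (u ^ 2)) * p1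
    - (-1) ^ N * (powerSum (coeffDeriv (3 / 2) (1 - N)) (u ^ 2)
      + Real.log u * powerSum (coeffGamma (3 / 2) (1 - N)) (u ^ 2)) * p2
    - (-1) ^ N * π * powerSum (coeffGamma 1 (1 / 2 - N)) (u ^ 2) * p3

/-- The Laplace transform of `w ^ j / (1 + w ^ 2) ^ n`. -/
noncomputable def laplaceRat (j n : ℕ) (z : ℝ) : ℝ :=
  ∫ w in Ioi (0 : ℝ), Real.exp (-(z * w)) * (w ^ j * ((1 + w ^ 2) ^ n)⁻¹)

theorem inv_one_add_sq_pow_le_one (w : ℝ) (n : ℕ) : ((1 + w ^ 2) ^ n)⁻¹ ≤ 1 :=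
  inv_le_one_of_one_le₀ (one_le_pow₀ (by nlinarith [sq_nonneg w]))

theorem integrableOn_exp_mul_pow (j : ℕ) {z : ℝ} (hz : 0 < z) :
    IntegrableOn (fun w : ℝ => Real.exp (-(z * w)) * w ^ j) (Ioi 0) := by
  have h := integrableOn_rpow_mul_exp_neg_mul_rpow (p := 1) (s := j) (b := z)
    (by have : (0 : ℝ) ≤ j := by positivity
        linarith) one_pos hz
  refine h.congr_fun (fun w _ => ?_) measurableSet_Ioi
  simp only [Real.rpow_one, Real.rpow_natCast]
  ring_nf

theorem continuous_rat (j n : ℕ) : Continuous fun w : ℝ => w ^ j * ((1 + w ^ 2) ^ n)⁻¹ :=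
  (continuous_pow j).mul (Continuous.inv₀ (by fun_prop) fun w => by positivity)

theorem integrableOn_laplaceRat (j n : ℕ) {z : ℝ} (hz : 0 < z) :
    IntegrableOn (fun w : ℝ => Real.exp (-(z * w)) * (w ^ j * ((1 + w ^ 2) ^ n)⁻¹)) (Ioi 0) := by
  have hc := continuous_rat j n
  refine (integrableOn_exp_mul_pow j hz).mono'
    (Continuous.aestronglyMeasurable (by fun_prop)) ?_
  refine (ae_restrict_iff' measurableSet_Ioi).2 (ae_of_all _ fun w (hw : 0 < w) => ?_)
  rw [Real.norm_of_nonneg (by positivity)]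
  have := inv_one_add_sq_pow_le_one w n
  gcongr
  exact mul_le_of_le_one_right (by positivity) this

theorem hasDerivAt_laplaceRat (j n : ℕ) {z : ℝ} (hz : 0 < z) :
    HasDerivAt (laplaceRat j n) (-laplaceRat (j + 1) n z) z := by
  have hc := continuous_rat j n
  have hc' := continuous_rat (j + 1) n
  have h := (hasDerivAt_integral_of_dominated_loc_of_deriv_le (μ := volume.restrict (Ioi (0 : ℝ)))
    (F := fun z w => Real.exp (-(z * w)) * (w ^ j * ((1 + w ^ 2) ^ n)⁻¹))
    (F' := fun z w => -(Real.exp (-(z * w)) * (w ^ (j + 1) * ((1 + w ^ 2) ^ n)⁻¹)))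
    (bound := fun w => Real.exp (-(z / 2 * w)) * w ^ (j + 1)) (x₀ := z)
    (Ioi_mem_nhds (show z / 2 < z by linarith))
    (Filter.Eventually.of_forall fun z => Continuous.aestronglyMeasurable (by fun_prop))
    (integrableOn_laplaceRat j n hz) (Continuous.aestronglyMeasurable (by fun_prop)) ?_
    (integrableOn_exp_mul_pow (j + 1) (by positivity)) ?_).2
  · exact h.congr_deriv (integral_neg _)
  · refine (ae_restrict_iff' measurableSet_Ioi).2
      (ae_of_all _ fun w (hw : 0 < w) y (hy : z / 2 < y) => ?_)
    rw [norm_neg, Real.norm_of_nonneg (by positivity)]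
    have := inv_one_add_sq_pow_le_one w n
    gcongr
    exact mul_le_of_le_one_right (by positivity) this
  · refine ae_of_all _ fun w y _ => ?_
    have h1 : HasDerivAt (fun y : ℝ => -(y * w)) (-w) y := by
      simpa using ((hasDerivAt_id y).mul_const w).fun_neg
    refine (h1.exp.mul_const _).congr_deriv ?_
    ring

theorem integral_exp_neg_mul {z : ℝ} (hz : 0 < z) :
    ∫ w in Ioi (0 : ℝ), Real.exp (-(z * w)) = 1 / z := by
  have := integral_exp_mul_Ioi (a := -z) (by linarith) 0
  simpa [neg_div_neg_eq] using this

theorem laplaceRat_zero_add_two {z : ℝ} (hz : 0 < z) :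
    laplaceRat 0 1 z + laplaceRat 2 1 z = 1 / z := by
  rw [laplaceRat, laplaceRat, ← integral_add (integrableOn_laplaceRat 0 1 hz)
    (integrableOn_laplaceRat 2 1 hz), ← integral_exp_neg_mul hz]
  refine integral_congr_ae (ae_of_all _ fun w => ?_)
  have : 1 + w ^ 2 ≠ 0 := by positivity
  simp only
  field_simp

theorem laplaceRat_succ (n : ℕ) {z : ℝ} (hz : 0 < z) :
    2 * n * laplaceRat 0 (n + 1) z = (2 * n - 1) * laplaceRat 0 n z + z * laplaceRat 1 n z := by
  have hder : ∀ w : ℝ, HasDerivAt (fun w : ℝ => Real.exp (-(z * w)) * (w ^ 1 * ((1 + w ^ 2) ^ n)⁻¹))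
      (-z * (Real.exp (-(z * w)) * (w ^ 1 * ((1 + w ^ 2) ^ n)⁻¹))
        + ((1 - 2 * n) * (Real.exp (-(z * w)) * (w ^ 0 * ((1 + w ^ 2) ^ n)⁻¹))
        + 2 * n * (Real.exp (-(z * w)) * (w ^ 0 * ((1 + w ^ 2) ^ (n + 1))⁻¹)))) w := by
    intro w
    have h0 : 1 + w ^ 2 ≠ 0 := by positivity
    have h1 : HasDerivAt (fun y : ℝ => -(z * y)) (-z) w := by
      simpa using ((hasDerivAt_id w).const_mul z).fun_neg
    have h2 : HasDerivAt (fun w : ℝ => 1 + w ^ 2) (2 * w) w := by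
      simpa using (hasDerivAt_pow 2 w).const_add 1
    have h3 := (h2.fun_pow n).fun_inv (pow_ne_zero n h0)
    refine (h1.exp.mul ((hasDerivAt_pow 1 w).fun_mul h3)).congr_deriv ?_
    rcases n with _ | n
    · simp
      ring
    · simp only [Nat.add_sub_cancel]
      field_simp
      push_cast
      ring
  have i1 := (integrableOn_laplaceRat 1 n hz).const_mul (-z)
  have i2 := (integrableOn_laplaceRat 0 n hz).const_mul (1 - 2 * n)
  have i3 := (integrableOn_laplaceRat 0 (n + 1) hz).const_mul (2 * n)
  have i23 : IntegrableOn (fun w : ℝ =>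
      (1 - 2 * n) * (Real.exp (-(z * w)) * (w ^ 0 * ((1 + w ^ 2) ^ n)⁻¹))
        + 2 * n * (Real.exp (-(z * w)) * (w ^ 0 * ((1 + w ^ 2) ^ (n + 1))⁻¹))) (Ioi 0) := i2.add i3
  have hlim : Filter.Tendsto (fun w : ℝ => Real.exp (-(z * w)) * (w ^ 1 * ((1 + w ^ 2) ^ n)⁻¹))
      Filter.atTop (nhds 0) := by
    have h := tendsto_rpow_mul_exp_neg_mul_atTop_nhds_zero 1 z hz
    refine squeeze_zero' ?_ ?_ h
    · filter_upwards [Filter.eventually_ge_atTop 0] with w hw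
      positivity
    · filter_upwards [Filter.eventually_ge_atTop 0] with w hw
      rw [Real.rpow_one, pow_one, mul_comm, neg_mul]
      have := inv_one_add_sq_pow_le_one w n
      gcongr
      exact mul_le_of_le_one_right hw this
  have h := integral_Ioi_of_hasDerivAt_of_tendsto' (a := 0) (fun w _ => hder w)
    (i1.add i23) hlim
  rw [integral_add i1 i23, integral_add i2 i3, integral_const_mul, integral_const_mul,
    integral_const_mul] at h
  simp only [laplaceRat]
  simp only [pow_one, mul_zero, zero_mul, sub_zero] at h ⊢
  linear_combination h

theorem integral_exp_neg_mul_log :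
    ∫ t in Ioi (0 : ℝ), Real.exp (-t) * Real.log t = -eulerMascheroniConstant := by
  have h1 := Complex.hasDerivAt_GammaIntegral (s := 1) (by simp)
  have h2 := Complex.hasDerivAt_Gamma_one
  have he : Complex.Gamma =ᶠ[nhds 1] Complex.GammaIntegral := by
    filter_upwards [(isOpen_lt continuous_const Complex.continuous_re).mem_nhds
      (show (0 : ℝ) < (1 : ℂ).re by simp)] with s hs
    exact Complex.Gamma_eq_integral hs
  have h3 := (h1.congr_of_eventuallyEq he).unique h2
  have h4 : ((∫ t in Ioi (0 : ℝ), Real.exp (-t) * Real.log t : ℝ) : ℂ)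
      = ((-eulerMascheroniConstant : ℝ) : ℂ) := by
    rw [← integral_complex_ofReal]
    push_cast
    rw [← h3]
    refine setIntegral_congr_fun measurableSet_Ioi fun t _ => ?_
    simp
    ring
  exact_mod_cast h4

theorem half_log_one_add_sq_le {t : ℝ} (ht : 0 ≤ t) : 1 / 2 * Real.log (1 + t ^ 2) ≤ t := by
  have h1 : Real.log (1 + t ^ 2) ≤ Real.log ((1 + t) ^ 2) :=
    Real.log_le_log (by positivity) (by nlinarith)
  rw [Real.log_pow] at h1
  have h2 := Real.log_le_sub_one_of_pos (show 0 < 1 + t by linarith)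
  push_cast at h1
  linarith

theorem integrableOn_exp_mul_log_one_add_sq {z a : ℝ} (hz : 0 < z) (ha : 0 ≤ a) :
    IntegrableOn (fun w : ℝ => Real.exp (-(z * w)) * (1 / 2 * Real.log (1 + (a * w) ^ 2)))
      (Ioi 0) := by
  refine ((integrableOn_exp_mul_pow 1 hz).const_mul a).mono' (by fun_prop) ?_
  refine (ae_restrict_iff' measurableSet_Ioi).2 (ae_of_all _ fun w (hw : 0 < w) => ?_)
  have h1 : 0 ≤ Real.log (1 + (a * w) ^ 2) :=
    Real.log_nonneg (by nlinarith [sq_nonneg (a * w)])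
  have h2 := half_log_one_add_sq_le (show 0 ≤ a * w by positivity)
  rw [Real.norm_of_nonneg (by positivity)]
  calc _ ≤ Real.exp (-(z * w)) * (a * w) := by gcongr
    _ = _ := by ring

theorem laplaceRat_one_one_eq {z : ℝ} (hz : 0 < z) :
    laplaceRat 1 1 z
      = ∫ t in Ioi (0 : ℝ), Real.exp (-t) * (1 / 2 * Real.log (1 + (z⁻¹ * t) ^ 2)) := by
  have hder : ∀ w : ℝ, HasDerivAt
      (fun w : ℝ => Real.exp (-(z * w)) * (1 / 2 * Real.log (1 + (1 * w) ^ 2)))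
      (-z * (Real.exp (-(z * w)) * (1 / 2 * Real.log (1 + (1 * w) ^ 2)))
        + Real.exp (-(z * w)) * (w ^ 1 * ((1 + w ^ 2) ^ 1)⁻¹)) w := by
    intro w
    have h0 : 1 + w ^ 2 ≠ 0 := by positivity
    have h1 : HasDerivAt (fun y : ℝ => -(z * y)) (-z) w := by
      simpa using ((hasDerivAt_id w).const_mul z).fun_neg
    have h2 : HasDerivAt (fun w : ℝ => 1 + (1 * w) ^ 2) (2 * w) w := by
      simpa using (hasDerivAt_pow 2 w).const_add 1
    refine (h1.exp.mul ((h2.log (by simpa using h0)).const_mul (1 / 2))).congr_deriv ?_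
    simp only [one_mul]
    field_simp
  have i1 := integrableOn_exp_mul_log_one_add_sq hz zero_le_one
  have i2 := integrableOn_laplaceRat 1 1 hz
  have hlim : Filter.Tendsto
      (fun w : ℝ => Real.exp (-(z * w)) * (1 / 2 * Real.log (1 + (1 * w) ^ 2)))
      Filter.atTop (nhds 0) := by
    refine squeeze_zero' ?_ ?_ (tendsto_rpow_mul_exp_neg_mul_atTop_nhds_zero 1 z hz)
    · filter_upwards [Filter.eventually_ge_atTop 0] with w hw
      have : 0 ≤ Real.log (1 + (1 * w) ^ 2) :=
        Real.log_nonneg (by nlinarith [sq_nonneg (1 * w)])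
      positivity
    · filter_upwards [Filter.eventually_ge_atTop 0] with w hw
      rw [Real.rpow_one, mul_comm w, neg_mul, one_mul]
      have := half_log_one_add_sq_le hw
      gcongr
  have h := integral_Ioi_of_hasDerivAt_of_tendsto' (a := 0) (fun w _ => hder w)
    ((i1.const_mul (-z)).add i2) hlim
  rw [integral_add (i1.const_mul (-z)) i2, integral_const_mul] at h
  have hs := integral_comp_mul_left_Ioi
    (fun t => Real.exp (-t) * (1 / 2 * Real.log (1 + (z⁻¹ * t) ^ 2))) 0 hz
  simp only [inv_mul_cancel_left₀ hz.ne', mul_zero, smul_eq_mul] at hs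
  simp only [one_mul] at h
  rw [hs, neg_mul, mul_inv_cancel_left₀ hz.ne'] at h
  simp only [laplaceRat]
  simp at h ⊢
  linarith

theorem tendsto_laplaceRat_one_one_add_log :
    Filter.Tendsto (fun z => laplaceRat 1 1 z + Real.log z) (nhdsWithin 0 (Ioi 0))
      (nhds (-eulerMascheroniConstant)) := by
  have hE : IntegrableOn (fun t : ℝ => Real.exp (-t)) (Ioi 0) := by
    simpa using integrableOn_exp_mul_pow 0 one_pos
  have hEt : IntegrableOn (fun t : ℝ => Real.exp (-t) * t) (Ioi 0) := by
    simpa using integrableOn_exp_mul_pow 1 one_pos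
  have heq : ∀ z : ℝ, 0 < z → laplaceRat 1 1 z + Real.log z
      = ∫ t in Ioi (0 : ℝ), Real.exp (-t) * (1 / 2 * Real.log (z ^ 2 + t ^ 2)) := by
    intro z hz
    have i1 := integrableOn_exp_mul_log_one_add_sq one_pos (inv_nonneg.2 hz.le)
    simp only [one_mul] at i1
    have h1 : ∫ t in Ioi (0 : ℝ), Real.exp (-t) * Real.log z = Real.log z := by
      rw [integral_mul_const, integral_exp_neg_Ioi_zero, one_mul]
    rw [laplaceRat_one_one_eq hz]
    nth_rewrite 1 [← h1]
    rw [← integral_add i1 (hE.mul_const _)]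
    refine setIntegral_congr_fun measurableSet_Ioi fun t (ht : 0 < t) => ?_
    have : z ^ 2 + t ^ 2 = z ^ 2 * (1 + (z⁻¹ * t) ^ 2) := by field_simp
    rw [this, Real.log_mul (by positivity) (by positivity), Real.log_pow]
    push_cast
    ring
  rw [← integral_exp_neg_mul_log]
  refine Filter.Tendsto.congr' (f₁ := fun z : ℝ =>
    ∫ t in Ioi (0 : ℝ), Real.exp (-t) * (1 / 2 * Real.log (z ^ 2 + t ^ 2))) ?_ ?_
  · filter_upwards [self_mem_nhdsWithin] with z hz using (heq z hz).symm
  refine tendsto_integral_filter_of_dominated_convergence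
    (fun t => 2 * (Real.exp (-t) * t) + 2 * (Real.exp (-t) * t ^ ((1 / 2 : ℝ) - 1)))
    (Filter.Eventually.of_forall fun z => by fun_prop) ?_
    ((hEt.const_mul 2).add ((Real.GammaIntegral_convergent one_half_pos).const_mul 2)) ?_
  · filter_upwards [Ioo_mem_nhdsGT (zero_lt_one' ℝ)] with z hz
    refine (ae_restrict_iff' measurableSet_Ioi).2 (ae_of_all _ fun t (ht : 0 < t) => ?_)
    have hz2 : z ^ 2 ≤ 1 := pow_le_one₀ hz.1.le hz.2.le
    have a1 : 1 / 2 * Real.log (z ^ 2 + t ^ 2) ≤ t := by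
      refine le_trans ?_ (half_log_one_add_sq_le ht.le)
      have := hz.1
      gcongr
    have a2 : Real.log t ≤ 1 / 2 * Real.log (z ^ 2 + t ^ 2) := by
      have : Real.log (t ^ 2) ≤ Real.log (z ^ 2 + t ^ 2) :=
        Real.log_le_log (by positivity) (by nlinarith [sq_nonneg z])
      rw [Real.log_pow] at this
      push_cast at this
      linarith
    have a3 : -Real.log t ≤ 2 * t ^ ((1 / 2 : ℝ) - 1) := by
      have := Real.log_le_rpow_div (inv_nonneg.2 ht.le) (one_half_pos (α := ℝ))
      rw [Real.log_inv, Real.inv_rpow ht.le, ← Real.rpow_neg ht.le] at this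
      norm_num at this ⊢
      linarith
    have a4 : 0 ≤ t ^ ((1 / 2 : ℝ) - 1) := by positivity
    rw [Real.norm_eq_abs, abs_mul, abs_of_pos (Real.exp_pos _)]
    have a5 : |1 / 2 * Real.log (z ^ 2 + t ^ 2)| ≤ 2 * t + 2 * t ^ ((1 / 2 : ℝ) - 1) :=
      abs_le.2 ⟨by linarith, by linarith⟩
    calc _ ≤ Real.exp (-t) * (2 * t + 2 * t ^ ((1 / 2 : ℝ) - 1)) := by gcongr
      _ = _ := by ring
  · refine (ae_restrict_iff' measurableSet_Ioi).2 (ae_of_all _ fun t (ht : 0 < t) => ?_)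
    have hc : ContinuousAt (fun z : ℝ => Real.exp (-t) * (1 / 2 * Real.log (z ^ 2 + t ^ 2))) 0 := by
      have : (0 : ℝ) ^ 2 + t ^ 2 ≠ 0 := by positivity
      fun_prop (disch := assumption)
    have := hc.tendsto.mono_left (nhdsWithin_le_nhds (s := Ioi (0 : ℝ)))
    convert this using 2
    rw [zero_pow two_ne_zero, zero_add, Real.log_pow]
    push_cast
    ring

theorem tendsto_laplaceRat_zero_one :
    Filter.Tendsto (laplaceRat 0 1) (nhdsWithin 0 (Ioi 0)) (nhds (π / 2)) := by
  have h0 : ∫ w in Ioi (0 : ℝ), (1 + w ^ 2)⁻¹ = π / 2 := by simp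
  rw [← h0]
  refine tendsto_integral_filter_of_dominated_convergence (fun w => (1 + w ^ 2)⁻¹)
    (Filter.Eventually.of_forall fun z => by fun_prop) ?_ integrable_inv_one_add_sq.integrableOn ?_
  · filter_upwards [self_mem_nhdsWithin] with z (hz : 0 < z)
    refine (ae_restrict_iff' measurableSet_Ioi).2 (ae_of_all _ fun w (hw : 0 < w) => ?_)
    rw [Real.norm_of_nonneg (by positivity), pow_zero, one_mul, pow_one]
    exact mul_le_of_le_one_left (by positivity) (Real.exp_le_one_iff.2 (by
      have := mul_pos hz hw
      linarith))
  · refine ae_of_all _ fun w => ?_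
    have hc : Continuous (fun z : ℝ => Real.exp (-(z * w)) * (w ^ 0 * ((1 + w ^ 2) ^ 1)⁻¹)) := by
      fun_prop
    have := (hc.tendsto 0).mono_left (nhdsWithin_le_nhds (s := Ioi (0 : ℝ)))
    simpa using this

theorem powerSum_eq_add_mul {c : ℕ → ℝ} (hc : IsEntireSeq c) (x : ℝ) :
    powerSum c x = c 0 + x * powerSum (fun k => c (k + 1)) x := by
  rw [powerSum, (hc.summable x).tsum_eq_zero_add, powerSum, ← tsum_mul_left, pow_zero, mul_one]
  congr 1
  exact tsum_congr fun k => by ring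

theorem IsEntireSeq.shift {c : ℕ → ℝ} (hc : IsEntireSeq c) : IsEntireSeq fun k => c (k + 1) := by
  intro r hr
  have h := (summable_nat_add_iff 1).2 (hc (r + 1) (by linarith))
  refine Summable.of_nonneg_of_le (fun k => by positivity) (fun k => ?_) h
  have : r ^ k ≤ (r + 1) ^ (k + 1) :=
    (pow_le_pow_left₀ hr (by linarith) k).trans
      (pow_le_pow_right₀ (by linarith) (Nat.le_succ k))
  gcongr

theorem tendsto_mul_log_nhdsGT_zero :
    Filter.Tendsto (fun u : ℝ => u * Real.log u) (nhdsWithin 0 (Ioi 0)) (nhds 0) := by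
  have h := Real.continuous_mul_log.tendsto 0
  rw [zero_mul] at h
  exact h.mono_left nhdsWithin_le_nhds

theorem tendsto_powerSum_sq {c : ℕ → ℝ} (hc : IsEntireSeq c) :
    Filter.Tendsto (fun u : ℝ => powerSum c (u ^ 2)) (nhdsWithin 0 (Ioi 0)) (nhds (c 0)) := by
  have h : Continuous fun u : ℝ => powerSum c (u ^ 2) :=
    (continuous_powerSum hc).comp (continuous_pow 2)
  have h0 := h.tendsto 0
  rw [zero_pow two_ne_zero, powerSum_at_zero] at h0
  exact h0.mono_left nhdsWithin_le_nhds

theorem tendsto_logSeries_zero {c d : ℕ → ℝ} (hc : IsEntireSeq c) (hd : IsEntireSeq d) :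
    Filter.Tendsto (logSeries 1 c d) (nhdsWithin 0 (Ioi 0)) (nhds 0) := by
  have hid : Filter.Tendsto (fun u : ℝ => u) (nhdsWithin 0 (Ioi 0)) (nhds 0) :=
    Filter.tendsto_id.mono_left nhdsWithin_le_nhds
  have h := (hid.mul (tendsto_powerSum_sq hc)).add
    (tendsto_mul_log_nhdsGT_zero.mul (tendsto_powerSum_sq hd))
  rw [zero_mul, zero_mul, add_zero] at h
  refine h.congr fun u => ?_
  rw [logSeries]
  ring

theorem tendsto_logSeries_div_sub_log {c d : ℕ → ℝ} (hc : IsEntireSeq c) (hd : IsEntireSeq d) :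
    Filter.Tendsto (fun u => logSeries 1 c d u / u - d 0 * Real.log u) (nhdsWithin 0 (Ioi 0))
      (nhds (c 0)) := by
  have h := (tendsto_powerSum_sq hc).add (tendsto_logSeries_zero isEntireSeq_zero hd.shift
    |>.mul (Filter.tendsto_id.mono_left (nhdsWithin_le_nhds (a := (0 : ℝ)) (s := Ioi 0))))
  rw [zero_mul, add_zero] at h
  refine h.congr' ?_
  filter_upwards [self_mem_nhdsWithin] with u (hu : 0 < u)
  rw [logSeries, logSeries, powerSum_zero, powerSum_eq_add_mul hd]
  simp only [id]
  field_simp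
  ring

/-- The non-logarithmic coefficients of the odd part of `besselStruve 0`. -/
noncomputable def oddCoeff (k : ℕ) : ℝ := coeffDeriv 1 (3 / 2) k + coeffDeriv (3 / 2) 1 k

theorem isEntireSeq_oddCoeff : IsEntireSeq oddCoeff :=
  (isEntireSeq_coeffDeriv _ _).add (isEntireSeq_coeffDeriv _ _)

theorem besselStruve_zero (u : ℝ) :
    besselStruve 0 u = logSeries 1 oddCoeff (fun k => 2 * coeffGamma 1 (3 / 2) k) u
      + π * logSeries 0 (coeffGamma 1 (1 / 2)) (fun _ => 0) u := by
  have h : powerSum oddCoeff (u ^ 2)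
      = powerSum (coeffDeriv 1 (3 / 2)) (u ^ 2) + powerSum (coeffDeriv (3 / 2) 1) (u ^ 2) :=
    powerSum_add (isEntireSeq_coeffDeriv _ _) (isEntireSeq_coeffDeriv _ _) _
  have h2 : coeffGamma (3 / 2) 1 = coeffGamma 1 (3 / 2) := by
    ext k; simp only [coeffGamma]; ring
  simp only [besselStruve, logSeries, h, powerSum_const_mul, Nat.cast_zero, zero_add, sub_zero,
    h2, mul_zero, pow_zero, pow_one]
  ring

theorem oddCoeff_zero :
    oddCoeff 0 = 2 / √π * (2 * eulerMascheroniConstant + 2 * Real.log 2 - 2) := by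
  have h1 := deriv_rGamma_eq (1 / 2)
  have h2 := rGamma_eq_mul (1 / 2)
  have e : (1 / 2 : ℝ) + 1 = 3 / 2 := by norm_num
  rw [deriv_rGamma_one_half, e] at h1
  rw [rGamma_one_half, e] at h2
  have h3 : rGamma 1 = 1 := by simp [rGamma]
  simp only [oddCoeff, coeffDeriv, Nat.cast_zero, zero_add, pow_zero, one_mul, deriv_rGamma_one, h3]
  have h5 : rGamma (3 / 2) = 2 / √π := by linear_combination -2 * h2
  rw [h5] at h1 ⊢
  linear_combination -2 * h1

theorem two_mul_coeffGamma_zero : 2 * coeffGamma 1 (3 / 2) 0 = 4 / √π := by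
  have h2 := rGamma_eq_mul (1 / 2)
  have e : (1 / 2 : ℝ) + 1 = 3 / 2 := by norm_num
  rw [rGamma_one_half, e] at h2
  have h3 : rGamma 1 = 1 := by simp [rGamma]
  simp only [coeffGamma, Nat.cast_zero, zero_add, pow_zero, one_mul, h3]
  linear_combination -4 * h2

/-- Image of `besselStruve 0` under the Euler operator `θ = u * d/du`, with the even and odd parts
collected. -/
noncomputable def eulerZero (u : ℝ) : ℝ :=
  logSeries 1 (fun k => 2 * (k * oddCoeff k) + ((1 : ℕ) * oddCoeff k + 2 * coeffGamma 1 (3 / 2) k))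
      (fun k => 2 * (k * (2 * coeffGamma 1 (3 / 2) k)) + (1 : ℕ) * (2 * coeffGamma 1 (3 / 2) k)) u
    + π * logSeries 0 (fun k => 2 * (k * coeffGamma 1 (1 / 2) k)
        + ((0 : ℕ) * coeffGamma 1 (1 / 2) k + 0)) (fun k => 2 * (k * 0) + (0 : ℕ) * 0) u

theorem hasDerivAt_besselStruve_zero {u : ℝ} (hu : 0 < u) :
    HasDerivAt (besselStruve 0) (eulerZero u / u) u := by
  have h1 := hasDerivAt_logSeries 1 isEntireSeq_oddCoeff
    ((isEntireSeq_coeffGamma 1 (3 / 2)).const_mul 2) hu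
  have h3 := hasDerivAt_logSeries 0 (isEntireSeq_coeffGamma 1 (1 / 2)) isEntireSeq_zero hu
  rw [funext besselStruve_zero]
  refine (h1.add (h3.const_mul π)).congr_deriv ?_
  rw [eulerZero]
  ring

theorem powerSum_eq_sub_add {c d e : ℕ → ℝ} {r : ℝ} (hc : IsEntireSeq c) (hd : IsEntireSeq d)
    (he : IsEntireSeq e) (h0 : c 0 = d 0 + r) (hs : ∀ k, c (k + 1) = d (k + 1) + -4 * e k) (x : ℝ) :
    powerSum c x = powerSum d x - 4 * x * powerSum e x + r := by
  rw [powerSum_eq_add_mul hc, powerSum_eq_add_mul hd, funext hs,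
    powerSum_add hd.shift (he.const_mul _), powerSum_const_mul, h0]
  ring

theorem hasDerivAt_eulerZero {u : ℝ} (hu : 0 < u) :
    HasDerivAt eulerZero ((eulerZero u - 4 * u ^ 2 * besselStruve 0 u + 4 * u / √π) / u) u := by
  have eO := isEntireSeq_oddCoeff
  have eG := isEntireSeq_coeffGamma
  have eD := isEntireSeq_coeffDeriv
  have e1 := ((eO.nat_mul.const_mul 2).add ((eO.const_mul (1 : ℕ)).add
    ((eG 1 (3 / 2)).const_mul 2)))
  have e2 := ((((eG 1 (3 / 2)).const_mul 2).nat_mul.const_mul 2).add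
    (((eG 1 (3 / 2)).const_mul 2).const_mul (1 : ℕ)))
  have e3 := (((eG 1 (1 / 2)).nat_mul.const_mul 2).add
    (((eG 1 (1 / 2)).const_mul (0 : ℕ)).add isEntireSeq_zero))
  have e4 : IsEntireSeq fun k => 2 * ((k : ℝ) * 0) + (0 : ℕ) * 0 := by
    simpa using isEntireSeq_zero
  have h1 := hasDerivAt_logSeries 1 e1 e2 hu
  have h3 := hasDerivAt_logSeries 0 e3 e4 hu
  refine (h1.add (h3.const_mul π)).congr_deriv ?_
  rw [besselStruve_zero, mul_div_assoc', ← add_div]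
  congr 1
  have f1 := (e1.nat_mul.const_mul 2).add ((e1.const_mul (1 : ℕ)).add e2)
  have f2 := (e2.nat_mul.const_mul 2).add (e2.const_mul (1 : ℕ))
  have f3 := (e3.nat_mul.const_mul 2).add ((e3.const_mul (0 : ℕ)).add e4)
  have g1 (k : ℕ) := rGamma_eq_mul ((k : ℝ) + 1)
  have g2 (k : ℕ) := rGamma_eq_mul ((k : ℝ) + 1 / 2)
  have g3 (k : ℕ) := rGamma_eq_mul ((k : ℝ) + 3 / 2)
  have g4 (k : ℕ) := deriv_rGamma_eq ((k : ℝ) + 1)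
  have g5 (k : ℕ) := deriv_rGamma_eq ((k : ℝ) + 3 / 2)
  have n1 (k : ℕ) : ((k + 1 : ℕ) : ℝ) + 1 = (k : ℝ) + 1 + 1 := by push_cast; ring
  have n2 (k : ℕ) : ((k + 1 : ℕ) : ℝ) + 1 / 2 = (k : ℝ) + 1 / 2 + 1 := by push_cast; ring
  have n3 (k : ℕ) : ((k + 1 : ℕ) : ℝ) + 3 / 2 = (k : ℝ) + 3 / 2 + 1 := by push_cast; ring
  have p1 := powerSum_eq_sub_add (r := 4 / √π) f1 e1 eO
    (by have := two_mul_coeffGamma_zero; push_cast; linear_combination this) (fun k => by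
      simp only [oddCoeff, coeffDeriv, coeffGamma, n1, n3, pow_succ, g1, g3, g4, g5]
      push_cast
      ring) (u ^ 2)
  have p2 := powerSum_eq_sub_add (r := 0) f2 e2 ((eG 1 (3 / 2)).const_mul 2)
    (by push_cast; ring) (fun k => by
      simp only [coeffGamma, n1, n3, pow_succ, g1, g3]
      push_cast
      ring) (u ^ 2)
  have p3 := powerSum_eq_sub_add (r := 0) f3 e3 (eG 1 (1 / 2))
    (by push_cast; ring) (fun k => by
      simp only [coeffGamma, n1, n2, pow_succ, g1, g2]
      push_cast
      ring) (u ^ 2)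
  have p4 : powerSum (fun k => 2 * ((k : ℝ) * (2 * ((k : ℝ) * 0) + (0 : ℕ) * 0))
      + (0 : ℕ) * (2 * ((k : ℝ) * 0) + (0 : ℕ) * 0)) (u ^ 2) = 0 := by
    simpa using powerSum_zero (u ^ 2)
  have p5 : powerSum (fun k => 2 * ((k : ℝ) * 0) + (0 : ℕ) * 0) (u ^ 2) = 0 := by
    simpa using powerSum_zero (u ^ 2)
  simp only [eulerZero, logSeries, p1, p2, p3, p4, p5, powerSum_zero]
  ring

theorem eq_zero_of_hasDerivAt_of_tendsto_zero {Y Z : ℝ → ℝ}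
    (hY : ∀ u, 0 < u → HasDerivAt Y (Z u) u) (hZ : ∀ u, 0 < u → HasDerivAt Z (-4 * Y u) u)
    (hY0 : Filter.Tendsto Y (nhdsWithin 0 (Ioi 0)) (nhds 0))
    (hZ0 : Filter.Tendsto Z (nhdsWithin 0 (Ioi 0)) (nhds 0)) {u : ℝ} (hu : 0 < u) : Y u = 0 := by
  have hE : ∀ v, 0 < v → HasDerivAt (fun v => Z v ^ 2 + 4 * Y v ^ 2) 0 v := fun v hv =>
    (((hZ v hv).fun_pow 2).fun_add (((hY v hv).fun_pow 2).const_mul 4)).congr_deriv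
      (by push_cast; ring)
  have hconst : ∀ v ∈ Ioi (0 : ℝ), Z v ^ 2 + 4 * Y v ^ 2 = Z u ^ 2 + 4 * Y u ^ 2 := fun v hv =>
    isOpen_Ioi.is_const_of_deriv_eq_zero isPreconnected_Ioi
      (fun w hw => (hE w hw).differentiableAt.differentiableWithinAt)
      (fun w hw => (hE w hw).deriv) hv hu
  have h0 := (hZ0.pow 2).add ((hY0.pow 2).const_mul 4)
  have h1 := tendsto_nhds_unique h0
    (tendsto_const_nhds.congr' (Filter.eventuallyEq_of_mem self_mem_nhdsWithin
      fun v hv => (hconst v hv).symm))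
  norm_num at h1
  nlinarith [sq_nonneg (Z u), sq_nonneg (Y u)]

theorem tendsto_two_mul_nhdsGT_zero :
    Filter.Tendsto (fun u : ℝ => 2 * u) (nhdsWithin 0 (Ioi 0)) (nhdsWithin 0 (Ioi 0)) := by
  refine tendsto_nhdsWithin_iff.2 ⟨?_, ?_⟩
  · have h : Filter.Tendsto (fun u : ℝ => 2 * u) (nhds 0) (nhds (2 * 0)) :=
      (continuous_const.mul continuous_id).tendsto 0
    rw [mul_zero] at h
    exact h.mono_left nhdsWithin_le_nhds
  · filter_upwards [self_mem_nhdsWithin] with u (hu : 0 < u)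
    exact mul_pos two_pos hu

theorem hasDerivAt_laplaceRat_two_mul (j n : ℕ) {u : ℝ} (hu : 0 < u) :
    HasDerivAt (fun u => laplaceRat j n (2 * u)) (-2 * laplaceRat (j + 1) n (2 * u)) u := by
  have h2 : HasDerivAt (fun u : ℝ => 2 * u) 2 u := by simpa using (hasDerivAt_id u).const_mul 2
  refine ((hasDerivAt_laplaceRat j n (mul_pos two_pos hu)).comp u h2).congr_deriv ?_
  ring

theorem tendsto_besselStruve_zero :
    Filter.Tendsto (besselStruve 0) (nhdsWithin 0 (Ioi 0)) (nhds √π) := by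
  have h1 := tendsto_logSeries_zero isEntireSeq_oddCoeff
    ((isEntireSeq_coeffGamma 1 (3 / 2)).const_mul 2)
  have h2 := (tendsto_powerSum_sq (isEntireSeq_coeffGamma 1 (1 / 2))).const_mul π
  have h3 : 0 + π * coeffGamma 1 (1 / 2) 0 = √π := by
    have h4 : rGamma 1 = 1 := by simp [rGamma]
    have h5 := Real.sq_sqrt pi_pos.le
    have h6 := Real.sqrt_pos.2 pi_pos
    simp only [coeffGamma, Nat.cast_zero, zero_add, h4, rGamma_one_half, pow_zero, one_mul]
    field_simp
    linarith
  have h := h1.add h2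
  rw [h3] at h
  refine h.congr fun u => ?_
  simp only [besselStruve_zero, logSeries, powerSum_zero]
  ring

theorem tendsto_eulerZero_div :
    Filter.Tendsto (fun u => eulerZero u / u - 4 / √π * Real.log u) (nhdsWithin 0 (Ioi 0))
      (nhds (oddCoeff 0 + 4 / √π)) := by
  have eO := isEntireSeq_oddCoeff
  have eG := isEntireSeq_coeffGamma
  have e1 := ((eO.nat_mul.const_mul 2).add ((eO.const_mul (1 : ℕ)).add
    ((eG 1 (3 / 2)).const_mul 2)))
  have e2 := ((((eG 1 (3 / 2)).const_mul 2).nat_mul.const_mul 2).add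
    (((eG 1 (3 / 2)).const_mul 2).const_mul (1 : ℕ)))
  have e3 := (((eG 1 (1 / 2)).nat_mul.const_mul 2).add
    (((eG 1 (1 / 2)).const_mul (0 : ℕ)).add isEntireSeq_zero))
  have h1 := tendsto_logSeries_div_sub_log e1 e2
  have hid : Filter.Tendsto (fun u : ℝ => u) (nhdsWithin 0 (Ioi 0)) (nhds 0) :=
    Filter.tendsto_id.mono_left nhdsWithin_le_nhds
  have h := h1.add ((hid.mul (tendsto_powerSum_sq e3.shift)).const_mul π)
  have hd := two_mul_coeffGamma_zero
  simp only [Nat.cast_zero, zero_mul, mul_zero, zero_add, Nat.cast_one, one_mul, add_zero, hd] at h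
  refine h.congr' ?_
  filter_upwards [self_mem_nhdsWithin] with u (hu : 0 < u)
  have p5 : powerSum (fun k => 2 * ((k : ℝ) * 0) + (0 : ℕ) * 0) (u ^ 2) = 0 := by
    simpa using powerSum_zero (u ^ 2)
  have p3 := powerSum_eq_add_mul e3 (u ^ 2)
  simp only [eulerZero]
  rw [add_div, logSeries.eq_def 0, p5, p3]
  simp only [Nat.cast_zero, zero_mul, mul_zero, zero_add, Nat.cast_one, one_mul, add_zero, pow_zero]
  field_simp
  ring

theorem laplaceRat_zero_one_eq {u : ℝ} (hu : 0 < u) :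
    laplaceRat 0 1 (2 * u) = √π / 2 * besselStruve 0 u := by
  have hpi := Real.sqrt_pos.2 pi_pos
  have h := eq_zero_of_hasDerivAt_of_tendsto_zero
    (Y := fun u => laplaceRat 0 1 (2 * u) - √π / 2 * besselStruve 0 u)
    (Z := fun u => -2 * laplaceRat 1 1 (2 * u) - √π / 2 * (eulerZero u / u))
    (fun u hu => (hasDerivAt_laplaceRat_two_mul 0 1 hu).fun_sub
      ((hasDerivAt_besselStruve_zero hu).const_mul _))
    (fun u hu => by
      refine (((hasDerivAt_laplaceRat_two_mul 1 1 hu).const_mul (-2)).fun_sub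
        (((hasDerivAt_eulerZero hu).fun_div (hasDerivAt_id u) hu.ne').const_mul _)).congr_deriv ?_
      have := laplaceRat_zero_add_two (mul_pos two_pos hu)
      rw [show laplaceRat (1 + 1) 1 (2 * u) = 1 / (2 * u) - laplaceRat 0 1 (2 * u) by
        rw [← this]; ring]
      simp only [id]
      field_simp
      ring)
    ?_ ?_ hu
  · linarith
  · have h := (tendsto_laplaceRat_zero_one.comp tendsto_two_mul_nhdsGT_zero).sub
      (tendsto_besselStruve_zero.const_mul (√π / 2))
    rw [show π / 2 - √π / 2 * √π = 0 by linear_combination (-1 / 2) * Real.sq_sqrt pi_pos.le] at h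
    exact h
  · have h := ((tendsto_laplaceRat_one_one_add_log.comp tendsto_two_mul_nhdsGT_zero).const_mul
      (-2)).add ((tendsto_const_nhds (x := 2 * Real.log 2)).sub
        (tendsto_eulerZero_div.const_mul (√π / 2)))
    rw [oddCoeff_zero, show -2 * -eulerMascheroniConstant + (2 * Real.log 2 - √π / 2 *
      (2 / √π * (2 * eulerMascheroniConstant + 2 * Real.log 2 - 2) + 4 / √π)) = 0 by
        field_simp; ring] at h
    refine h.congr' ?_
    filter_upwards [self_mem_nhdsWithin] with u (hu : 0 < u)
    simp only [Function.comp]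
    rw [Real.log_mul two_ne_zero hu.ne']
    field_simp
    ring

theorem laplaceRat_zero_succ_eq (N : ℕ) {u : ℝ} (hu : 0 < u) :
    laplaceRat 0 (N + 1) (2 * u) = √π / 2 / N.factorial * besselStruve N u := by
  induction N generalizing u with
  | zero => simpa using laplaceRat_zero_one_eq hu
  | succ N ih =>
    have h1 := hasDerivAt_laplaceRat_two_mul 0 (N + 1) hu
    have h2 := (hasDerivAt_besselStruve N hu).const_mul (√π / 2 / N.factorial)
    have h3 := h1.unique (h2.congr_of_eventuallyEq
      (Filter.eventuallyEq_of_mem (Ioi_mem_nhds hu) fun v hv => ih hv))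
    have h4 := laplaceRat_succ (N + 1) (mul_pos two_pos hu)
    have h5 := besselStruve_succ N u
    rw [ih hu] at h4
    have h6 : 2 * u * laplaceRat 1 (N + 1) (2 * u)
        = -(√π / 2 / N.factorial * eulerBesselStruve N u) := by
      have : u * (eulerBesselStruve N u / u) = eulerBesselStruve N u := by field_simp
      linear_combination -u * h3 - √π / 2 / N.factorial * this
    rw [h6] at h4
    have hN : (N.factorial : ℝ) ≠ 0 := by positivity
    have hN1 : ((N : ℝ) + 1) ≠ 0 := by positivity
    rw [Nat.factorial_succ]
    push_cast at h4 ⊢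
    field_simp at h4 ⊢
    linear_combination 1 / 2 * h4 - √π / 2 * h5

theorem cauchySchlomilch_hasDerivAt (w u : ℝ) {y : ℝ} (hy : 0 < y) :
    HasDerivAt (fun y => w * y - u / y) (w + u / y ^ 2) y := by
  have h := ((hasDerivAt_id y).const_mul w).fun_sub
    ((hasDerivAt_const y u).fun_div (hasDerivAt_id y) hy.ne')
  refine h.congr_deriv ?_
  simp only [id]
  field_simp
  ring

theorem cauchySchlomilch_injOn {w u : ℝ} (hw : 0 < w) (hu : 0 < u) :
    InjOn (fun y : ℝ => w * y - u / y) (Ioi 0) := by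
  refine StrictMonoOn.injOn fun x (hx : 0 < x) y _ hxy => ?_
  have h1 : u / y < u / x := div_lt_div_of_pos_left hu hx hxy
  have h2 : w * x < w * y := mul_lt_mul_of_pos_left hxy hw
  linarith

theorem cauchySchlomilch_image {w u : ℝ} (hw : 0 < w) (hu : 0 < u) :
    (fun y : ℝ => w * y - u / y) '' Ioi 0 = univ := by
  refine eq_univ_of_forall fun t => ?_
  have h4 : 0 ≤ t ^ 2 + 4 * w * u := by positivity
  have hs := Real.sq_sqrt h4
  have habs : |t| < √(t ^ 2 + 4 * w * u) :=
    Real.lt_sqrt_of_sq_lt (by rw [sq_abs]; nlinarith [mul_pos hw hu])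
  have hpos : 0 < t + √(t ^ 2 + 4 * w * u) := by linarith [neg_abs_le t]
  refine ⟨(t + √(t ^ 2 + 4 * w * u)) / (2 * w), div_pos hpos (by linarith), ?_⟩
  generalize √(t ^ 2 + 4 * w * u) = s at hs hpos
  have hpos' := hpos.ne'
  simp only
  field_simp
  linear_combination hs

theorem integrableOn_cauchySchlomilch {w u : ℝ} (hw : 0 < w) (hu : 0 < u) :
    IntegrableOn (fun y : ℝ => Real.exp (-(w * y - u / y) ^ 2)) (Ioi 0) := by
  have h := (integrableOn_image_iff_integrableOn_abs_deriv_smul measurableSet_Ioi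
    (fun y hy => (cauchySchlomilch_hasDerivAt w u hy).hasDerivWithinAt)
    (cauchySchlomilch_injOn hw hu) (fun t => Real.exp (-t ^ 2))).1 (by
      rw [cauchySchlomilch_image hw hu, integrableOn_univ]
      simpa using integrable_exp_neg_mul_sq one_pos)
  refine (h.const_mul w⁻¹).mono' (by fun_prop) ?_
  refine (ae_restrict_iff' measurableSet_Ioi).2 (ae_of_all _ fun y (hy : 0 < y) => ?_)
  rw [Real.norm_of_nonneg (Real.exp_pos _).le, smul_eq_mul, ← mul_assoc,
    abs_of_pos (by positivity)]
  refine le_mul_of_one_le_left (Real.exp_pos _).le ?_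
  rw [mul_add, inv_mul_cancel₀ hw.ne']
  have : 0 < w⁻¹ * (u / y ^ 2) := by positivity
  linarith

theorem integral_cauchySchlomilch {w u : ℝ} (hw : 0 < w) (hu : 0 < u) :
    ∫ y in Ioi (0 : ℝ), Real.exp (-(w * y - u / y) ^ 2) = √π / (2 * w) := by
  have hi := integrableOn_cauchySchlomilch hw hu
  have h1 := integral_image_eq_integral_abs_deriv_smul measurableSet_Ioi
    (fun y hy => (cauchySchlomilch_hasDerivAt w u hy).hasDerivWithinAt)
    (cauchySchlomilch_injOn hw hu) (fun t => Real.exp (-t ^ 2))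
  have hg : ∫ t : ℝ, Real.exp (-t ^ 2) = √π := by simpa using integral_gaussian 1
  rw [cauchySchlomilch_image hw hu, setIntegral_univ, hg] at h1
  have hc : 0 < u / w := by positivity
  have hd : ∀ y ∈ Ioi (0 : ℝ),
      HasDerivWithinAt (fun y => u / w / y) (-(u / w) / y ^ 2) (Ioi 0) y := fun y (hy : 0 < y) => by
    refine (((hasDerivAt_const y (u / w)).fun_div (hasDerivAt_id y) hy.ne').congr_deriv
      ?_).hasDerivWithinAt
    simp only [id]
    ring
  have hinj : InjOn (fun y : ℝ => u / w / y) (Ioi 0) := by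
    intro x (hx : 0 < x) y (hy : 0 < y) hxy
    simp only at hxy
    field_simp at hxy
    exact hxy.symm
  have himg : (fun y : ℝ => u / w / y) '' Ioi 0 = Ioi 0 := by
    refine Subset.antisymm ?_ fun y (hy : 0 < y) => ⟨u / w / y, div_pos hc hy, by
      simp only; field_simp⟩
    rintro _ ⟨y, hy : 0 < y, rfl⟩
    exact div_pos hc hy
  have h2 := integral_image_eq_integral_abs_deriv_smul measurableSet_Ioi hd hinj
    (fun y => Real.exp (-(w * y - u / y) ^ 2))
  rw [himg] at h2
  have h3 : ∀ y ∈ Ioi (0 : ℝ), |w + u / y ^ 2| • Real.exp (-(w * y - u / y) ^ 2)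
      = w * Real.exp (-(w * y - u / y) ^ 2) + w * (|-(u / w) / y ^ 2| •
        Real.exp (-(w * (u / w / y) - u / (u / w / y)) ^ 2)) := by
    intro y (hy : 0 < y)
    have e1 : w * (u / w / y) - u / (u / w / y) = -(w * y - u / y) := by field_simp; ring
    rw [e1, neg_sq, neg_div, abs_neg, abs_of_pos (by positivity), abs_of_pos (by positivity),
      smul_eq_mul, smul_eq_mul]
    field_simp
  have hi2 := (integrableOn_image_iff_integrableOn_abs_deriv_smul measurableSet_Ioi hd hinj
    (fun y => Real.exp (-(w * y - u / y) ^ 2))).1 (by rwa [himg])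
  rw [setIntegral_congr_fun measurableSet_Ioi h3,
    integral_add (hi.const_mul w) (hi2.const_mul w), integral_const_mul, integral_const_mul,
    ← h2] at h1
  rw [eq_div_iff (by positivity)]
  linarith

theorem uGamma_one_sub_eq (n : ℕ) {x : ℝ} (hx : 0 < x) :
    uGamma (1 - n) x = ∫ w in Ioi (0 : ℝ),
      2 * x * w * (((x * (1 + w ^ 2)) ^ n)⁻¹ * Real.exp (-(x * (1 + w ^ 2)))) := by
  have hd : ∀ w ∈ Ioi (0 : ℝ),
      HasDerivWithinAt (fun w => x * (1 + w ^ 2)) (2 * x * w) (Ioi 0) w := fun w _ =>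
    ((((hasDerivAt_pow 2 w).const_add 1).const_mul x).congr_deriv
      (by push_cast; ring)).hasDerivWithinAt
  have hinj : InjOn (fun w : ℝ => x * (1 + w ^ 2)) (Ioi 0) := by
    intro v (hv : 0 < v) w (hw : 0 < w) h
    have h' : v ^ 2 = w ^ 2 := by simpa using mul_left_cancel₀ hx.ne' h
    exact (pow_left_inj₀ hv.le hw.le two_ne_zero).1 h'
  have himg : (fun w : ℝ => x * (1 + w ^ 2)) '' Ioi 0 = Ioi x := by
    refine Subset.antisymm ?_ fun v (hv : x < v) => ?_
    · rintro _ ⟨w, hw : 0 < w, rfl⟩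
      have : 0 < x * w ^ 2 := by positivity
      simp only [mem_Ioi]
      linarith
    · have h : 0 < v / x - 1 := by rw [sub_pos, lt_div_iff₀ hx]; linarith
      refine ⟨√(v / x - 1), Real.sqrt_pos.2 h, ?_⟩
      simp only [Real.sq_sqrt h.le]
      field_simp
      ring
  rw [uGamma, ← himg, integral_image_eq_integral_abs_deriv_smul measurableSet_Ioi hd hinj]
  refine setIntegral_congr_fun measurableSet_Ioi fun w (hw : 0 < w) => ?_
  have hp : 0 < x * (1 + w ^ 2) := by positivity
  simp only [smul_eq_mul]
  rw [abs_of_pos (by positivity), show (1 - (n : ℝ) - 1) = -n by ring, Real.rpow_neg hp.le,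
    Real.rpow_natCast]

theorem integral_uGamma_eq_laplaceRat (n : ℕ) {u : ℝ} (hu : 0 < u) :
    ∫ x in Ioi (0 : ℝ), Real.exp (x - u ^ 2 / x) * x ^ ((n : ℝ) - 3 / 2) * uGamma (1 - n) x
      = 2 * √π * laplaceRat 0 n (2 * u) := by
  have key : ∀ y w : ℝ, 0 < y →
      Real.exp (-(u ^ 2 / y ^ 2)) * Real.exp (-(y ^ 2 * w ^ 2))
        = Real.exp (-(2 * u * w)) * Real.exp (-(w * y - u / y) ^ 2) := fun y w hy => by
    rw [← Real.exp_add, ← Real.exp_add]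
    congr 1
    field_simp
    ring
  set f : ℝ → ℝ → ℝ := fun y w =>
    4 * w * ((1 + w ^ 2) ^ n)⁻¹ * (Real.exp (-(u ^ 2 / y ^ 2)) * Real.exp (-(y ^ 2 * w ^ 2)))
    with hf
  have hfeq : ∀ w : ℝ, ∀ y ∈ Ioi (0 : ℝ), f y w = 4 * w * ((1 + w ^ 2) ^ n)⁻¹ *
      Real.exp (-(2 * u * w)) * Real.exp (-(w * y - u / y) ^ 2) := fun w y hy => by
    rw [hf]
    simp only
    rw [key y w hy]
    ring
  have hfi : ∀ w ∈ Ioi (0 : ℝ), IntegrableOn (fun y => f y w) (Ioi 0) := fun w hw =>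
    IntegrableOn.congr_fun ((integrableOn_cauchySchlomilch hw hu).const_mul _)
      (fun y hy => (hfeq w y hy).symm) measurableSet_Ioi
  have hfv : ∀ w ∈ Ioi (0 : ℝ), ∫ y in Ioi (0 : ℝ), f y w
      = 2 * √π * (Real.exp (-(2 * u * w)) * (w ^ 0 * ((1 + w ^ 2) ^ n)⁻¹)) := fun w hw => by
    rw [setIntegral_congr_fun measurableSet_Ioi (hfeq w), integral_const_mul,
      integral_cauchySchlomilch hw hu]
    have : w ≠ 0 := (mem_Ioi.1 hw).ne'
    field_simp
    ring
  have hprod : Integrable (Function.uncurry f)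
      ((volume.restrict (Ioi 0)).prod (volume.restrict (Ioi 0))) := by
    have hm : Measurable (Function.uncurry f) := by
      simp only [hf, Function.uncurry_def]
      fun_prop
    refine (integrable_prod_iff' hm.aestronglyMeasurable).2 ⟨?_, ?_⟩
    · exact (ae_restrict_iff' measurableSet_Ioi).2 (ae_of_all _ hfi)
    · refine IntegrableOn.congr_fun
        ((integrableOn_laplaceRat 0 n (mul_pos two_pos hu)).const_mul (2 * √π))
        (fun w hw => ?_) measurableSet_Ioi
      rw [← hfv w hw]
      refine setIntegral_congr_fun measurableSet_Ioi fun y _ => ?_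
      have hw' : 0 < w := hw
      simp only [Function.uncurry]
      rw [Real.norm_of_nonneg]
      simp only [hf]
      positivity
  have hleft : ∫ x in Ioi (0 : ℝ),
      Real.exp (x - u ^ 2 / x) * x ^ ((n : ℝ) - 3 / 2) * uGamma (1 - n) x
        = ∫ y in Ioi (0 : ℝ), ∫ w in Ioi (0 : ℝ), f y w := by
    rw [← integral_comp_rpow_Ioi_of_pos two_pos]
    refine setIntegral_congr_fun measurableSet_Ioi fun y (hy : 0 < y) => ?_
    rw [Real.rpow_two, uGamma_one_sub_eq n (by positivity), smul_eq_mul, ← mul_assoc,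
      ← integral_const_mul]
    refine setIntegral_congr_fun measurableSet_Ioi fun w (hw : 0 < w) => ?_
    have e1 : (y ^ 2) ^ ((n : ℝ) - 3 / 2) = (y ^ 2) ^ n / y ^ 3 := by
      rw [Real.rpow_sub (by positivity), Real.rpow_natCast, ← Real.rpow_natCast y 2,
        ← Real.rpow_mul hy.le, ← Real.rpow_natCast y 3]
      norm_num
    have e2 : y ^ ((2 : ℝ) - 1) = y := by norm_num
    have e3 : Real.exp (-(y ^ 2 * (1 + w ^ 2)))
        = Real.exp (-(y ^ 2)) * Real.exp (-(y ^ 2 * w ^ 2)) := by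
      rw [← Real.exp_add]; ring_nf
    have e4 : Real.exp (y ^ 2 - u ^ 2 / y ^ 2)
        = Real.exp (-(u ^ 2 / y ^ 2)) * (Real.exp (-(y ^ 2)))⁻¹ := by
      rw [← Real.exp_neg, ← Real.exp_add]; ring_nf
    simp only [hf]
    rw [e1, e2, e3, e4, mul_pow]
    field_simp
    ring
  rw [hleft, integral_integral_swap hprod, setIntegral_congr_fun measurableSet_Ioi hfv,
    integral_const_mul, laplaceRat]

theorem integral_uGamma_eq_bessel_struve_deriv (n : ℕ) (hn : 1 ≤ n) (b : ℝ) (hb : 0 < b) :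
    ∫ x in Set.Ioi (0:ℝ),
        Real.exp (x - b / x) * x ^ ((n : ℝ) - 3 / 2) * uGamma (1 - (n : ℝ)) x
      = (Real.pi * b ^ ((n : ℝ) / 2 - 1 / 4) / ((n - 1).factorial : ℝ)) *
        (deriv (fun α => besselJ α (2 * Real.sqrt b)) ((n : ℝ) - 1 / 2)
          - (-1 : ℝ) ^ n * deriv (fun α => struveH α (2 * Real.sqrt b)) (1 / 2 - (n : ℝ))
          - (-1 : ℝ) ^ n * Real.pi * besselJ (1 / 2 - (n : ℝ)) (2 * Real.sqrt b)) := by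
  obtain ⟨N, rfl⟩ : ∃ N, n = N + 1 := ⟨n - 1, by omega⟩
  have hu : 0 < √b := Real.sqrt_pos.2 hb
  have hN : (N.factorial : ℝ) ≠ 0 := by positivity
  have hpi := Real.sq_sqrt pi_pos.le
  have h := integral_uGamma_eq_laplaceRat (N + 1) hu
  rw [Real.sq_sqrt hb.le, laplaceRat_zero_succ_eq N hu, besselStruve_eq N hu] at h
  have e1 : b ^ (((N + 1 : ℕ) : ℝ) / 2 - 1 / 4) = √b ^ ((N : ℝ) + 1 / 2) := by
    rw [Real.sqrt_eq_rpow, ← Real.rpow_mul hb.le]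
    congr 1
    push_cast
    ring
  have e2 : ((N + 1 : ℕ) : ℝ) - 1 / 2 = N + 1 / 2 := by push_cast; ring
  have e3 : (1 / 2 : ℝ) - ((N + 1 : ℕ) : ℝ) = -1 / 2 - N := by push_cast; ring
  rw [h, e1, e2, e3, Nat.add_sub_cancel, pow_succ]
  field_simp
  rw [hpi]
  ring
end
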